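/- arXiv:2106.04002 — 2 statements merged into one kernel-verified Lean document; each statement's English description precedes it below -/
import Mathlib

section
/- Let 1 ≤ p < ∞ and let K ⊆ 𝕋 be compact with m(K) = 0. For every g ∈ H^p(𝔻), every continuous function φ on K and every ε > 0, there exists a complex polynomial P such that ‖P − g‖_{H^p} < ε and sup_{ζ∈K} |P(ζ) − φ(ζ)| < ε. -/
open Complex Metric Set Filter MeasureTheory Polynomial Topology

noncomputable section

/-- The Hardy `p`-norm of a function `f` on the unit disk:
`sup_{0<r<1} ((1/2π) ∫_0^{2π} |f(r e^{iθ})|^p dθ)^{1/p}`. -/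
def hardyNorm (p : ℝ) (f : ℂ → ℂ) : ℝ :=
  ⨆ r : Set.Ioo (0:ℝ) 1,
    ((1 / (2 * Real.pi)) *
      ∫ θ in (0:ℝ)..(2 * Real.pi),
        ‖f (((r : ℝ) : ℂ) * Complex.exp ((θ : ℂ) * Complex.I))‖ ^ p) ^ (1 / p)

/-- Membership in the Hardy space `H^p(𝔻)`: `f` is holomorphic on the unit disk and the
means `((1/2π) ∫_0^{2π} |f(r e^{iθ})|^p dθ)^{1/p}` are uniformly bounded for `0 < r < 1`. -/
def MemHp (p : ℝ) (f : ℂ → ℂ) : Prop :=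
  DifferentiableOn ℂ f (Metric.ball (0:ℂ) 1) ∧
  BddAbove (Set.range fun r : Set.Ioo (0:ℝ) 1 =>
    ((1 / (2 * Real.pi)) *
      ∫ θ in (0:ℝ)..(2 * Real.pi),
        ‖f (((r : ℝ) : ℂ) * Complex.exp ((θ : ℂ) * Complex.I))‖ ^ p) ^ (1 / p))

/-- The Hardy space `H^p(𝔻)` as a type. -/
def HpSpace (p : ℝ) := {f : ℂ → ℂ // MemHp p f}

/-- The norm topology on `H^p(𝔻)`, generated by the open balls of the Hardy norm. -/
instance hpTopology (p : ℝ) : TopologicalSpace (HpSpace p) :=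
  TopologicalSpace.generateFrom
    {U : Set (HpSpace p) | ∃ (f : HpSpace p) (ε : ℝ), 0 < ε ∧
      U = {g : HpSpace p | hardyNorm p (fun z => g.1 z - f.1 z) < ε}}

/-- The arc length measure of a subset `K` of the unit circle `𝕋 ⊆ ℂ`, computed as the
Lebesgue measure of the set of angles `θ ∈ [0, 2π)` with `e^{iθ} ∈ K`. -/
def arcMeasure (K : Set ℂ) : ENNReal :=
  MeasureTheory.volume {θ : ℝ | θ ∈ Set.Ico (0:ℝ) (2 * Real.pi) ∧
    Complex.exp ((θ : ℂ) * Complex.I) ∈ K}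

/-- The mean value over `[0, 2π]` of a real function of the angle. -/
def angleMean (u : ℝ → ℝ) : ℝ := (1 / (2 * Real.pi)) * ∫ θ in (0:ℝ)..(2 * Real.pi), u θ

lemma angleMean_mono {u v : ℝ → ℝ} (hu : Continuous u) (hv : Continuous v) (h : ∀ θ, u θ ≤ v θ) :
    angleMean u ≤ angleMean v := by
  unfold angleMean
  gcongr
  exact intervalIntegral.integral_mono Real.two_pi_pos.le (hu.intervalIntegrable _ _)
    (hv.intervalIntegrable _ _) h

lemma angleMean_add {u v : ℝ → ℝ} (hu : Continuous u) (hv : Continuous v) :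
    angleMean (fun θ => u θ + v θ) = angleMean u + angleMean v := by
  unfold angleMean
  rw [intervalIntegral.integral_add (hu.intervalIntegrable _ _) (hv.intervalIntegrable _ _)]
  ring

lemma angleMean_const_mul (c : ℝ) (u : ℝ → ℝ) :
    angleMean (fun θ => c * u θ) = c * angleMean u := by
  unfold angleMean
  rw [intervalIntegral.integral_const_mul]
  ring

lemma angleMean_const (c : ℝ) : angleMean (fun _ => c) = c := by
  unfold angleMean
  have := Real.pi_pos
  rw [intervalIntegral.integral_const, smul_eq_mul]
  field_simp
  ring

lemma angleMean_nonneg {u : ℝ → ℝ} (h : ∀ θ, 0 ≤ u θ) : 0 ≤ angleMean u :=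
  mul_nonneg (by positivity)
    (intervalIntegral.integral_nonneg Real.two_pi_pos.le fun θ _ => h θ)

lemma angleMean_le_const {u : ℝ → ℝ} (hu : Continuous u) {c : ℝ} (h : ∀ θ, u θ ≤ c) :
    angleMean u ≤ c := by
  simpa [angleMean_const] using angleMean_mono hu continuous_const h

lemma continuous_angleMean {u : ℝ → ℝ → ℝ} (hu : Continuous (Function.uncurry u)) :
    Continuous fun r => angleMean (u r) :=
  continuous_const.mul
    (intervalIntegral.continuous_parametric_intervalIntegral_of_continuous' hu _ _)

lemma continuous_circle (r : ℝ) : Continuous fun θ : ℝ => (r : ℂ) * exp ((θ : ℂ) * I) := by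
  fun_prop

lemma norm_circle {r : ℝ} (hr : 0 ≤ r) (θ : ℝ) : ‖(r : ℂ) * exp ((θ : ℂ) * I)‖ = r := by
  simp [norm_exp_ofReal_mul_I, abs_of_nonneg hr]

lemma continuous_comp_circle {f : ℂ → ℂ} (hf : ContinuousOn f (ball 0 1)) {r : ℝ}
    (hr : r ∈ Ioo (0:ℝ) 1) : Continuous fun θ : ℝ => f ((r : ℂ) * exp ((θ : ℂ) * I)) :=
  hf.comp_continuous (continuous_circle r) fun θ => by
    rw [mem_ball_zero_iff, norm_circle hr.1.le]
    exact hr.2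

lemma integral_exp_pow_mul_conj (n m : ℕ) :
    ∫ θ in (0:ℝ)..(2 * Real.pi), exp ((θ : ℂ) * I) ^ n * (starRingEnd ℂ) (exp ((θ : ℂ) * I) ^ m) =
      if n = m then 2 * (Real.pi : ℂ) else 0 := by
  have key : ∀ θ : ℝ, exp ((θ : ℂ) * I) ^ n * (starRingEnd ℂ) (exp ((θ : ℂ) * I) ^ m) =
      exp ((((n : ℂ) - m) * I) * θ) := by
    intro θ
    rw [map_pow, ← exp_conj, ← exp_nat_mul, ← exp_nat_mul, ← exp_add]
    congr 1
    simp
    ring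
  simp_rw [key]
  split_ifs with h
  · simp [h]
  · have hc : ((n : ℂ) - m) * I ≠ 0 :=
      mul_ne_zero (sub_ne_zero.2 (by exact_mod_cast h)) I_ne_zero
    rw [integral_exp_mul_complex hc]
    have : exp (((n : ℂ) - m) * I * ((2 * Real.pi : ℝ) : ℂ)) = 1 :=
      exp_eq_one_iff.2 ⟨(n : ℤ) - m, by push_cast; ring⟩
    rw [this]
    simp

lemma hasSum_integral_powerSeries_mul {b : ℕ → ℂ} (hb : Summable fun n => ‖b n‖) {F G : ℝ → ℂ}
    (hF : ∀ θ : ℝ, HasSum (fun n => b n * exp ((θ : ℂ) * I) ^ n) (F θ)) (hG : Continuous G) :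
    HasSum (fun n => b n * ∫ θ in (0:ℝ)..(2 * Real.pi), exp ((θ : ℂ) * I) ^ n * G θ)
      (∫ θ in (0:ℝ)..(2 * Real.pi), F θ * G θ) := by
  have := intervalIntegral.hasSum_integral_of_dominated_convergence (μ := volume)
    (a := 0) (b := 2 * Real.pi) (F := fun n (θ : ℝ) => b n * (exp ((θ : ℂ) * I) ^ n * G θ))
    (f := fun θ => F θ * G θ) (fun n θ => ‖b n‖ * ‖G θ‖) (fun n => by fun_prop)
    (fun n => Eventually.of_forall fun θ _ => by simp [norm_exp_ofReal_mul_I])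
    (Eventually.of_forall fun θ _ => hb.mul_right _)
    (by
      simp_rw [tsum_mul_right]
      exact Continuous.intervalIntegrable (by fun_prop) _ _)
    (Eventually.of_forall fun θ _ => by simpa [mul_assoc] using (hF θ).mul_right (G θ))
  simpa [intervalIntegral.integral_const_mul] using this

lemma continuous_of_hasSum_circle {b : ℕ → ℂ} (hb : Summable fun n => ‖b n‖) {F : ℝ → ℂ}
    (hF : ∀ θ : ℝ, HasSum (fun n => b n * exp ((θ : ℂ) * I) ^ n) (F θ)) : Continuous F := by
  have : F = fun θ : ℝ => ∑' n, b n * exp ((θ : ℂ) * I) ^ n := funext fun θ => (hF θ).tsum_eq.symm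
  rw [this]
  exact continuous_tsum (fun n => by fun_prop) hb fun n θ => by simp [norm_exp_ofReal_mul_I]

/-- Parseval's identity for absolutely convergent power series on the unit circle. -/
lemma hasSum_sq_norm_coeff {b : ℕ → ℂ} (hb : Summable fun n => ‖b n‖) {F : ℝ → ℂ}
    (hF : ∀ θ : ℝ, HasSum (fun n => b n * exp ((θ : ℂ) * I) ^ n) (F θ)) :
    HasSum (fun n => ‖b n‖ ^ 2) (angleMean fun θ => ‖F θ‖ ^ 2) := by
  have hFc := continuous_of_hasSum_circle hb hF
  have hπ : (Real.pi : ℂ) ≠ 0 := by exact_mod_cast Real.pi_ne_zero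
  have h1 : ∀ m : ℕ, ∫ θ in (0:ℝ)..(2 * Real.pi),
      F θ * (starRingEnd ℂ) (exp ((θ : ℂ) * I) ^ m) = b m * (2 * Real.pi) := by
    intro m
    have h := hasSum_integral_powerSeries_mul hb hF
      (G := fun θ : ℝ => (starRingEnd ℂ) (exp ((θ : ℂ) * I) ^ m)) (by fun_prop)
    simp_rw [integral_exp_pow_mul_conj] at h
    refine h.unique ?_
    convert! hasSum_ite_eq m (b m * (2 * (Real.pi : ℂ))) using 2 with n
    split_ifs with hnm <;> simp [hnm]
  have h2 : ∀ m : ℕ, ∫ θ in (0:ℝ)..(2 * Real.pi),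
      exp ((θ : ℂ) * I) ^ m * (starRingEnd ℂ) (F θ) = (starRingEnd ℂ) (b m) * (2 * Real.pi) := by
    intro m
    have := congrArg (starRingEnd ℂ) (h1 m)
    rw [← intervalIntegral.intervalIntegral_conj] at this
    simpa [mul_comm, mul_left_comm, map_ofNat (starRingEnd ℂ) 2] using this
  have h3 := hasSum_integral_powerSeries_mul hb hF (G := fun θ => (starRingEnd ℂ) (F θ))
    (by fun_prop)
  simp_rw [h2, mul_conj'] at h3
  rw [← hasSum_ofReal]
  convert! h3.mul_left (1 / (2 * (Real.pi : ℂ))) using 2 with n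
  · rw [← mul_assoc (b n), mul_conj']
    push_cast
    field_simp
  · unfold angleMean
    push_cast
    rw [← intervalIntegral.integral_ofReal]
    push_cast
    rfl

lemma exists_hasSum_pow {R : ℝ} {f : ℂ → ℂ} (hf : DifferentiableOn ℂ f (ball 0 R)) :
    ∃ a : ℕ → ℂ, ∀ z ∈ ball (0:ℂ) R, HasSum (fun n => a n * z ^ n) (f z) :=
  ⟨fun n => (n.factorial : ℂ)⁻¹ * iteratedDeriv n f 0, fun z hz => by
    convert! hasSum_taylorSeries_on_ball hf hz using 2 with n
    simp only [sub_zero, smul_eq_mul]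
    ring⟩

lemma summable_norm_coeff_mul_pow {R : ℝ} {f : ℂ → ℂ} {a : ℕ → ℂ}
    (ha : ∀ z ∈ ball (0:ℂ) R, HasSum (fun n => a n * z ^ n) (f z)) {r : ℝ} (hr : 0 ≤ r)
    (hrR : r < R) : Summable fun n => ‖a n‖ * r ^ n := by
  have := (ha (r : ℂ) (by simpa [abs_of_nonneg hr] using hrR)).summable.norm
  simpa [abs_of_nonneg hr] using this

/-- A function holomorphic in a neighbourhood of the closed unit disk is a uniform limit of
polynomials there. -/
lemma exists_polynomial_near_of_differentiableOn {R : ℝ} (hR : 1 < R) {f : ℂ → ℂ}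
    (hf : DifferentiableOn ℂ f (ball 0 R)) {δ : ℝ} (hδ : 0 < δ) :
    ∃ P : Polynomial ℂ, ∀ z ∈ closedBall (0:ℂ) 1, ‖P.eval z - f z‖ ≤ δ := by
  obtain ⟨a, ha⟩ := exists_hasSum_pow hf
  have hs : Summable fun n => ‖a n‖ := by
    simpa using summable_norm_coeff_mul_pow ha zero_le_one hR
  have hu := tendstoUniformlyOn_tsum_nat (f := fun n (z : ℂ) => a n * z ^ n)
    (s := closedBall (0:ℂ) 1) hs (fun n z hz => by
      rw [norm_mul, norm_pow]
      exact mul_le_of_le_one_right (norm_nonneg _)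
        (pow_le_one₀ (norm_nonneg _) (by simpa using hz)))
  obtain ⟨N, hN⟩ := (Metric.tendstoUniformlyOn_iff.1 hu δ hδ).exists
  refine ⟨∑ n ∈ Finset.range N, C (a n) * X ^ n, fun z hz => ?_⟩
  have h := hN z hz
  rw [(ha z (closedBall_subset_ball hR hz)).tsum_eq, dist_comm, dist_eq_norm] at h
  simpa [eval_finsetSum] using h.le

lemma exists_polynomial_ne_zero_near_of_differentiableOn {R : ℝ} (hR : 1 < R) {f : ℂ → ℂ}
    (hf : DifferentiableOn ℂ f (ball 0 R)) {δ : ℝ} (hδ : 0 < δ) :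
    ∃ P : Polynomial ℂ, P ≠ 0 ∧ ∀ z ∈ closedBall (0:ℂ) 1, ‖P.eval z - f z‖ ≤ δ := by
  obtain ⟨P, hP⟩ := exists_polynomial_near_of_differentiableOn hR hf (half_pos hδ)
  by_cases h : P = 0
  · refine ⟨C ((δ / 2 : ℝ) : ℂ), by simpa using hδ.ne', fun z hz => ?_⟩
    have h1 := hP z hz
    rw [h, eval_zero, zero_sub, norm_neg] at h1
    rw [eval_C]
    refine (norm_sub_le _ _).trans ?_
    rw [norm_real, Real.norm_of_nonneg (half_pos hδ).le]
    linarith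
  · exact ⟨P, h, fun z hz => (hP z hz).trans (by linarith)⟩

/-- `f` is, on the unit disk, the sum of a power series whose coefficients have square sum at most
`M`, i.e. `f` belongs to the closed ball of radius `√M` of the Hardy space `H²`. -/
def HardySqLE (M : ℝ) (f : ℂ → ℂ) : Prop :=
  ∃ a : ℕ → ℂ, (∀ z ∈ ball (0:ℂ) 1, HasSum (fun n => a n * z ^ n) (f z)) ∧
    ∀ N, ∑ n ∈ Finset.range N, ‖a n‖ ^ 2 ≤ M

lemma HardySqLE.mono {M M' : ℝ} {f : ℂ → ℂ} (h : HardySqLE M f) (hM : M ≤ M') :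
    HardySqLE M' f := by
  obtain ⟨a, h1, h2⟩ := h
  exact ⟨a, h1, fun N => (h2 N).trans hM⟩

lemma hasSum_circle {R : ℝ} {f : ℂ → ℂ} {a : ℕ → ℂ}
    (ha : ∀ z ∈ ball (0:ℂ) R, HasSum (fun n => a n * z ^ n) (f z)) {r : ℝ} (hr : 0 ≤ r)
    (hrR : r < R) (θ : ℝ) : HasSum (fun n => (a n * (r : ℂ) ^ n) * exp ((θ : ℂ) * I) ^ n)
      (f ((r : ℂ) * exp ((θ : ℂ) * I))) := by
  simpa [mul_pow, mul_assoc] using ha ((r : ℂ) * exp ((θ : ℂ) * I))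
    (by rw [mem_ball_zero_iff, norm_circle hr]; exact hrR)

lemma hasSum_sq_norm_coeff_circle {R : ℝ} {f : ℂ → ℂ} {a : ℕ → ℂ}
    (ha : ∀ z ∈ ball (0:ℂ) R, HasSum (fun n => a n * z ^ n) (f z)) {r : ℝ} (hr : 0 ≤ r)
    (hrR : r < R) : HasSum (fun n => ‖a n‖ ^ 2 * (r ^ n) ^ 2)
      (angleMean fun θ => ‖f ((r : ℂ) * exp ((θ : ℂ) * I))‖ ^ 2) := by
  have := hasSum_sq_norm_coeff (b := fun n => a n * (r : ℂ) ^ n)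
    (by simpa [abs_of_nonneg hr] using summable_norm_coeff_mul_pow ha hr hrR)
    (hasSum_circle ha hr hrR)
  simpa [abs_of_nonneg hr, mul_pow] using this

lemma HardySqLE.of_sq_norm_le {q : ℂ → ℂ} (hq : DifferentiableOn ℂ q (ball 0 1)) {H : ℂ → ℝ}
    (hH : Continuous H) (hle : ∀ z ∈ ball (0:ℂ) 1, ‖q z‖ ^ 2 ≤ H z) :
    HardySqLE (angleMean fun θ => H (exp ((θ : ℂ) * I))) q := by
  obtain ⟨a, ha⟩ := exists_hasSum_pow hq
  refine ⟨a, ha, fun N => ?_⟩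
  have hmean : Continuous fun r : ℝ => angleMean fun θ => H ((r : ℂ) * exp ((θ : ℂ) * I)) :=
    continuous_angleMean (u := fun r θ => H ((r : ℂ) * exp ((θ : ℂ) * I)))
      (by unfold Function.uncurry; fun_prop)
  have hsum : Continuous fun r : ℝ => ∑ n ∈ Finset.range N, ‖a n‖ ^ 2 * (r ^ n) ^ 2 := by
    fun_prop
  have hlim := le_of_tendsto_of_tendsto (b := 𝓝[<] (1:ℝ))
    (hsum.continuousWithinAt (s := Iio 1) (x := 1)).tendsto
    (hmean.continuousWithinAt (s := Iio 1) (x := 1)).tendsto (by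
      filter_upwards [Ioo_mem_nhdsLT (zero_lt_one (α := ℝ))] with r hr
      have hS := hasSum_sq_norm_coeff_circle ha hr.1.le hr.2
      calc _ ≤ angleMean fun θ => ‖q ((r : ℂ) * exp ((θ : ℂ) * I))‖ ^ 2 :=
            sum_le_hasSum _ (fun n _ => by positivity) hS
        _ ≤ _ := angleMean_mono ((continuous_comp_circle hq.continuousOn hr).norm.pow 2)
            (by fun_prop) fun θ => hle _ (by
              rw [mem_ball_zero_iff, norm_circle hr.1.le]; exact hr.2))
  simpa using hlim

lemma HardySqLE.angleMean_le {M : ℝ} {f : ℂ → ℂ} (h : HardySqLE M f) {r : ℝ}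
    (hr : r ∈ Ioo (0:ℝ) 1) :
    angleMean (fun θ => ‖f ((r : ℂ) * exp ((θ : ℂ) * I))‖ ^ 2) ≤ M := by
  obtain ⟨a, ha, hM⟩ := h
  have hS := hasSum_sq_norm_coeff_circle ha hr.1.le hr.2
  refine le_of_tendsto' hS.tendsto_sum_nat fun N => (Finset.sum_le_sum fun n _ => ?_).trans (hM N)
  exact mul_le_of_le_one_right (by positivity)
    (pow_le_one₀ (by have := hr.1; positivity) (pow_le_one₀ hr.1.le hr.2.le))

lemma HardySqLE.continuous_circle {M : ℝ} {f : ℂ → ℂ} (h : HardySqLE M f) {r : ℝ}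
    (hr : r ∈ Ioo (0:ℝ) 1) : Continuous fun θ : ℝ => f ((r : ℂ) * exp ((θ : ℂ) * I)) := by
  obtain ⟨a, ha, -⟩ := h
  exact continuous_of_hasSum_circle (b := fun n => a n * (r : ℂ) ^ n)
    (by simpa [abs_of_nonneg hr.1.le] using summable_norm_coeff_mul_pow ha hr.1.le hr.2)
    (hasSum_circle ha hr.1.le hr.2)

/-- The dilations of an `H²` function are Cauchy in quadratic mean. -/
lemma HardySqLE.exists_dilation_cauchy {M : ℝ} {f : ℂ → ℂ} (h : HardySqLE M f) {δ : ℝ}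
    (hδ : 0 < δ) : ∃ ρ ∈ Ioo (0:ℝ) 1, ∀ r ∈ Ico ρ 1, ∀ s ∈ Ico ρ 1,
      angleMean (fun θ => ‖f ((r : ℂ) * exp ((θ : ℂ) * I)) -
        f ((s : ℂ) * exp ((θ : ℂ) * I))‖ ^ 2) ≤ δ := by
  obtain ⟨a, ha, hM⟩ := h
  have hsq : Summable fun n => ‖a n‖ ^ 2 :=
    summable_of_sum_range_le (fun n => by positivity) hM
  have hbound : ∀ ρ ∈ Ioo (0:ℝ) 1, ∀ n : ℕ, 0 ≤ 1 - ρ ^ n ∧ 1 - ρ ^ n ≤ 1 := fun ρ hρ n =>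
    ⟨sub_nonneg.2 (pow_le_one₀ hρ.1.le hρ.2.le), sub_le_self _ (pow_nonneg hρ.1.le n)⟩
  have hlim : Tendsto (fun ρ : ℝ => ∑' n, ‖a n‖ ^ 2 * (1 - ρ ^ n) ^ 2) (𝓝[<] 1)
      (𝓝 (∑' _ : ℕ, (0:ℝ))) := by
    refine tendsto_tsum_of_dominated_convergence hsq (fun n => ?_) ?_
    · have : Continuous fun ρ : ℝ => ‖a n‖ ^ 2 * (1 - ρ ^ n) ^ 2 := by fun_prop
      simpa using (this.continuousWithinAt (s := Iio 1) (x := 1)).tendsto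
    · filter_upwards [Ioo_mem_nhdsLT (zero_lt_one (α := ℝ))] with ρ hρ n
      rw [Real.norm_of_nonneg (by positivity)]
      exact mul_le_of_le_one_right (by positivity)
        (pow_le_one₀ (hbound ρ hρ n).1 (hbound ρ hρ n).2)
  rw [tsum_zero] at hlim
  obtain ⟨ρ, hlt, hρ⟩ := ((hlim.eventually (gt_mem_nhds hδ)).and
    (Ioo_mem_nhdsLT (zero_lt_one (α := ℝ)))).exists
  refine ⟨ρ, hρ, fun r hr s hs => ?_⟩
  have hr0 : 0 ≤ r := hρ.1.le.trans hr.1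
  have hs0 : 0 ≤ s := hρ.1.le.trans hs.1
  have hsr : Summable fun n => ‖a n‖ * r ^ n := summable_norm_coeff_mul_pow ha hr0 hr.2
  have hss : Summable fun n => ‖a n‖ * s ^ n := summable_norm_coeff_mul_pow ha hs0 hs.2
  have hS := hasSum_sq_norm_coeff (b := fun n => a n * (r : ℂ) ^ n - a n * (s : ℂ) ^ n)
    (F := fun θ => f ((r : ℂ) * exp ((θ : ℂ) * I)) - f ((s : ℂ) * exp ((θ : ℂ) * I)))
    (Summable.of_nonneg_of_le (fun n => norm_nonneg _) (fun n => by
      refine (norm_sub_le _ _).trans_eq ?_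
      simp [abs_of_nonneg hr0, abs_of_nonneg hs0]) (hsr.add hss))
    (fun θ => by
      simpa [sub_mul] using (hasSum_circle ha hr0 hr.2 θ).sub (hasSum_circle ha hs0 hs.2 θ))
  refine le_trans (hasSum_le (fun n => ?_) hS (Summable.hasSum ?_)) hlt.le
  · rw [← mul_sub, norm_mul, mul_pow]
    gcongr
    have h1 := pow_le_pow_left₀ hρ.1.le hr.1 n
    have h2 := pow_le_pow_left₀ hρ.1.le hs.1 n
    have h3 := pow_le_one₀ (n := n) hr0 hr.2.le
    have h4 := pow_le_one₀ (n := n) hs0 hs.2.le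
    rw [show (r : ℂ) ^ n - (s : ℂ) ^ n = ((r ^ n - s ^ n : ℝ) : ℂ) by push_cast; rfl, norm_real,
      Real.norm_eq_abs, abs_le]
    constructor <;> linarith
  · exact Summable.of_nonneg_of_le (fun n => by positivity) (fun n =>
      mul_le_of_le_one_right (by positivity)
        (pow_le_one₀ (hbound ρ hρ n).1 (hbound ρ hρ n).2)) hsq

/-- Along an ultrafilter, a bounded family in `H²` converges pointwise on the disk to a function
obeying the same bound. -/
lemma exists_tendsto_hardySqLE {ι : Type*} (U : Ultrafilter ι) {M : ℝ} {F : ι → ℂ → ℂ}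
    (hF : ∀ i, HardySqLE M (F i)) :
    ∃ f, HardySqLE M f ∧ ∀ z ∈ ball (0:ℂ) 1, Tendsto (fun i => F i z) U (𝓝 (f z)) := by
  choose a ha hM using hF
  have hle : ∀ i n, ‖a i n‖ ≤ √M := fun i n => Real.le_sqrt_of_sq_le <|
    (Finset.single_le_sum (f := fun n => ‖a i n‖ ^ 2) (fun _ _ => by positivity)
      (Finset.self_mem_range_succ n)).trans (hM i (n + 1))
  have hlim : ∀ n, ∃ c, Tendsto (fun i => a i n) U (𝓝 c) := by
    intro n
    obtain ⟨c, -, hc⟩ := (isCompact_closedBall (0:ℂ) (√M)).ultrafilter_le_nhds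
      (U.map fun i => a i n) (le_principal_iff.2 (Filter.mem_map.2
        (Filter.univ_mem' fun i => by simpa using hle i n)))
    exact ⟨c, hc⟩
  choose c hc using hlim
  have hcle : ∀ n, ‖c n‖ ≤ √M := fun n =>
    le_of_tendsto (hc n).norm (Eventually.of_forall fun i => hle i n)
  have hgeo : ∀ z ∈ ball (0:ℂ) 1, Summable fun n : ℕ => √M * ‖z‖ ^ n := fun z hz =>
    (summable_geometric_of_lt_one (norm_nonneg z) (by simpa using hz)).mul_left _
  refine ⟨fun z => ∑' n, c n * z ^ n, ⟨c, fun z hz => ?_, fun N => ?_⟩, fun z hz => ?_⟩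
  · refine Summable.hasSum (Summable.of_norm_bounded (hgeo z hz) fun n => ?_)
    rw [norm_mul, norm_pow]
    gcongr
    exact hcle n
  · exact le_of_tendsto (tendsto_finsetSum _ fun n _ => (hc n).norm.pow 2)
      (Eventually.of_forall fun i => hM i N)
  · simp_rw [← fun i => (ha i z hz).tsum_eq]
    refine tendsto_tsum_of_dominated_convergence (hgeo z hz) (fun n => (hc n).mul_const _)
      (Eventually.of_forall fun i n => ?_)
    rw [norm_mul, norm_pow]
    gcongr
    exact hle i n

/-- `h` dominates `T` on the closed unit disk, with equality of moduli on the circle, has no zeros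
in the open disk, and its modulus has holomorphic real powers there. -/
def IsOuterMajorant (h T : ℂ → ℂ) : Prop :=
  Continuous h ∧ (∀ z ∈ ball (0:ℂ) 1, h z ≠ 0) ∧ (∀ z ∈ closedBall (0:ℂ) 1, ‖T z‖ ≤ ‖h z‖) ∧
    (∀ z ∈ sphere (0:ℂ) 1, ‖T z‖ = ‖h z‖) ∧
    ∀ s : ℝ, ∃ q : ℂ → ℂ, DifferentiableOn ℂ q (ball 0 1) ∧ ∀ z ∈ ball (0:ℂ) 1, ‖q z‖ = ‖h z‖ ^ s

lemma IsOuterMajorant.mul {h₁ h₂ T₁ T₂ : ℂ → ℂ} (H₁ : IsOuterMajorant h₁ T₁)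
    (H₂ : IsOuterMajorant h₂ T₂) :
    IsOuterMajorant (fun z => h₁ z * h₂ z) fun z => T₁ z * T₂ z := by
  obtain ⟨c₁, n₁, l₁, e₁, q₁⟩ := H₁
  obtain ⟨c₂, n₂, l₂, e₂, q₂⟩ := H₂
  refine ⟨c₁.mul c₂, fun z hz => mul_ne_zero (n₁ z hz) (n₂ z hz), fun z hz => ?_,
    fun z hz => ?_, fun s => ?_⟩
  · rw [norm_mul, norm_mul]
    exact mul_le_mul (l₁ z hz) (l₂ z hz) (norm_nonneg _) (norm_nonneg _)
  · rw [norm_mul, norm_mul, e₁ z hz, e₂ z hz]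
  · obtain ⟨u, hu, hu'⟩ := q₁ s
    obtain ⟨v, hv, hv'⟩ := q₂ s
    refine ⟨fun z => u z * v z, hu.mul hv, fun z hz => ?_⟩
    rw [norm_mul, norm_mul, hu' z hz, hv' z hz, Real.mul_rpow (norm_nonneg _) (norm_nonneg _)]

lemma isOuterMajorant_const {c : ℂ} (hc : c ≠ 0) :
    IsOuterMajorant (fun _ => c) fun _ => c :=
  ⟨continuous_const, fun _ _ => hc, fun _ _ => le_rfl, fun _ _ => rfl, fun s =>
    ⟨fun _ => c ^ (s : ℂ), differentiableOn_const _, fun _ _ => norm_cpow_real _ _⟩⟩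

lemma exists_differentiableOn_norm_eq_rpow {b : ℂ} (hb : ‖b‖ ≤ 1) (s : ℝ) :
    ∃ q : ℂ → ℂ, DifferentiableOn ℂ q (ball 0 1) ∧ ∀ z ∈ ball (0:ℂ) 1, ‖q z‖ = ‖1 - b * z‖ ^ s := by
  refine ⟨fun z => (1 - b * z) ^ (s : ℂ), fun z hz => ?_, fun z _ => norm_cpow_real _ _⟩
  have hlt : ‖b * z‖ < 1 := by
    rw [norm_mul]
    exact (mul_le_of_le_one_left (norm_nonneg _) hb).trans_lt (by simpa using hz)
  have hre : 1 - b * z ∈ slitPlane := by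
    left
    have := (re_le_norm (b * z)).trans_lt hlt
    rw [sub_re, one_re]
    linarith
  have hd : DifferentiableAt ℂ (fun z => 1 - b * z) z := by fun_prop
  exact (hd.cpow_const hre).differentiableWithinAt

lemma one_sub_mul_ne_zero {b z : ℂ} (hb : ‖b‖ ≤ 1) (hz : z ∈ ball (0:ℂ) 1) : 1 - b * z ≠ 0 := by
  intro h
  have h1 : ‖b * z‖ = 1 := by rw [← sub_eq_zero.1 h, norm_one]
  have : ‖b * z‖ < 1 := by
    rw [norm_mul]
    exact (mul_le_of_le_one_left (norm_nonneg _) hb).trans_lt (by simpa using hz)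
  linarith

lemma isOuterMajorant_sub_of_one_le {a : ℂ} (ha : 1 ≤ ‖a‖) :
    IsOuterMajorant (fun z => z - a) fun z => z - a := by
  have ha0 : a ≠ 0 := norm_pos_iff.1 (by linarith)
  have hb : ‖a⁻¹‖ ≤ 1 := by rw [norm_inv]; exact inv_le_one_of_one_le₀ ha
  have hfac : ∀ z, z - a = -a * (1 - a⁻¹ * z) := fun z => by field_simp; ring
  refine ⟨by fun_prop, fun z hz => ?_, fun _ _ => le_rfl, fun _ _ => rfl, fun s => ?_⟩
  · beta_reduce
    rw [hfac]
    exact mul_ne_zero (neg_ne_zero.2 ha0) (one_sub_mul_ne_zero hb hz)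
  · obtain ⟨q, hq, hq'⟩ := exists_differentiableOn_norm_eq_rpow hb s
    refine ⟨fun z => (-a) ^ (s : ℂ) * q z, hq.const_mul _, fun z hz => ?_⟩
    beta_reduce
    rw [hfac, norm_mul, norm_mul, hq' z hz, norm_cpow_real,
      Real.mul_rpow (norm_nonneg _) (norm_nonneg _)]

lemma sq_norm_one_sub_conj_mul_sub (a z : ℂ) :
    ‖1 - (starRingEnd ℂ) a * z‖ ^ 2 - ‖z - a‖ ^ 2 = (1 - ‖a‖ ^ 2) * (1 - ‖z‖ ^ 2) := by
  simp only [← normSq_eq_norm_sq, normSq_apply, sub_re, sub_im, mul_re, mul_im, one_re, one_im,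
    conj_re, conj_im]
  ring

lemma isOuterMajorant_sub_of_lt_one {a : ℂ} (ha : ‖a‖ < 1) :
    IsOuterMajorant (fun z => 1 - (starRingEnd ℂ) a * z) fun z => z - a := by
  have hb : ‖(starRingEnd ℂ) a‖ ≤ 1 := by rw [RCLike.norm_conj]; exact ha.le
  refine ⟨by fun_prop, fun z hz => one_sub_mul_ne_zero hb hz, fun z hz => ?_, fun z hz => ?_,
    exists_differentiableOn_norm_eq_rpow hb⟩
  · have h1 : ‖a‖ ^ 2 ≤ 1 := pow_le_one₀ (norm_nonneg _) ha.le
    have h2 : ‖z‖ ^ 2 ≤ 1 := pow_le_one₀ (norm_nonneg _) (by simpa using hz)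
    refine le_of_sq_le_sq ?_ (norm_nonneg _)
    nlinarith [sq_norm_one_sub_conj_mul_sub a z, mul_nonneg (sub_nonneg.2 h1) (sub_nonneg.2 h2)]
  · have h2 : ‖z‖ = 1 := by simpa using hz
    have := sq_norm_one_sub_conj_mul_sub a z
    rw [h2] at this
    refine (pow_left_inj₀ (norm_nonneg _) (norm_nonneg _) two_ne_zero).1 ?_
    linarith

lemma exists_isOuterMajorant {T : Polynomial ℂ} (hT : T ≠ 0) :
    ∃ h, IsOuterMajorant h fun z => T.eval z := by
  have hroots : ∀ s : Multiset ℂ,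
      ∃ h, IsOuterMajorant h fun z => (s.map fun a => z - a).prod := by
    intro s
    induction s using Multiset.induction_on with
    | empty => exact ⟨_, by simpa using isOuterMajorant_const one_ne_zero⟩
    | cons a s ih =>
      obtain ⟨h, hh⟩ := ih
      simp only [Multiset.map_cons, Multiset.prod_cons]
      rcases lt_or_ge ‖a‖ 1 with ha | ha
      · exact ⟨_, (isOuterMajorant_sub_of_lt_one ha).mul hh⟩
      · exact ⟨_, (isOuterMajorant_sub_of_one_le ha).mul hh⟩
  obtain ⟨h, hh⟩ := hroots T.roots
  have heval : (fun z => T.eval z) =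
      fun z => T.leadingCoeff * (T.roots.map fun a => z - a).prod := by
    funext z
    exact (IsAlgClosed.splits T).eval_eq_prod_roots z
  rw [heval]
  exact ⟨_, (isOuterMajorant_const (leadingCoeff_ne_zero.2 hT)).mul hh⟩

lemma add_rpow_le_two_rpow_mul {x y p : ℝ} (hx : 0 ≤ x) (hy : 0 ≤ y) (hp : 0 ≤ p) :
    (x + y) ^ p ≤ 2 ^ p * (x ^ p + y ^ p) := by
  have hmax : (max x y) ^ p ≤ x ^ p + y ^ p := by
    rcases max_cases x y with ⟨h, -⟩ | ⟨h, -⟩ <;> rw [h] <;>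
      linarith [Real.rpow_nonneg hx p, Real.rpow_nonneg hy p]
  calc (x + y) ^ p ≤ (2 * max x y) ^ p :=
        Real.rpow_le_rpow (by positivity) (by linarith [le_max_left x y, le_max_right x y]) hp
    _ = 2 ^ p * (max x y) ^ p := Real.mul_rpow zero_le_two (le_max_of_le_left hx)
    _ ≤ _ := by gcongr

lemma self_le_one_add_rpow {x p : ℝ} (hx : 0 ≤ x) (hp : 1 ≤ p) : x ≤ 1 + x ^ p := by
  rcases le_total x 1 with h | h
  · linarith [Real.rpow_nonneg hx p]
  · have := Real.rpow_le_rpow_of_exponent_le h hp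
    rw [Real.rpow_one] at this
    linarith

/-- `T` is a product of two functions of `H²` and `‖T‖ ^ p` is dominated by `‖m‖ ^ 2` for some `m`
in `H²`, all with bounds in terms of `M`. -/
def HasHardyFactors (p M : ℝ) (T : ℂ → ℂ) : Prop :=
  ∃ f k m, HardySqLE (1 + M) f ∧ HardySqLE (1 + M) k ∧ HardySqLE M m ∧
    ∀ z ∈ ball (0:ℂ) 1, T z = f z * k z ∧ ‖T z‖ ^ p ≤ ‖m z‖ ^ 2

lemma hasHardyFactors_polynomial {p : ℝ} (hp : 1 ≤ p) {T : Polynomial ℂ} (hT : T ≠ 0) {M : ℝ}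
    (hM : angleMean (fun θ => ‖T.eval (exp ((θ : ℂ) * I))‖ ^ p) ≤ M) :
    HasHardyFactors p M fun z => T.eval z := by
  have hp0 : 0 ≤ p := zero_le_one.trans hp
  obtain ⟨h, hc, hne, hle, heq, hpow⟩ := exists_isOuterMajorant hT
  have hcirc : ∀ θ : ℝ, ‖h (exp ((θ : ℂ) * I))‖ = ‖T.eval (exp ((θ : ℂ) * I))‖ := fun θ =>
    (heq _ (by simp [norm_exp_ofReal_mul_I])).symm
  have hTc : Continuous fun θ : ℝ => ‖T.eval (exp ((θ : ℂ) * I))‖ := by fun_prop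
  have hTp : Continuous fun θ : ℝ => ‖T.eval (exp ((θ : ℂ) * I))‖ ^ p :=
    hTc.rpow_const fun _ => Or.inr hp0
  have hmean1 : angleMean (fun θ => ‖h (exp ((θ : ℂ) * I))‖) ≤ 1 + M := by
    simp_rw [hcirc]
    calc _ ≤ angleMean fun θ => 1 + ‖T.eval (exp ((θ : ℂ) * I))‖ ^ p :=
          angleMean_mono hTc (by fun_prop) fun θ => self_le_one_add_rpow (norm_nonneg _) hp
      _ ≤ 1 + M := by
          rw [angleMean_add continuous_const hTp, angleMean_const]
          linarith
  have hmeanp : angleMean (fun θ => ‖h (exp ((θ : ℂ) * I))‖ ^ p) ≤ M := by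
    simp_rw [hcirc]
    exact hM
  obtain ⟨k, hk, hk'⟩ := hpow (1 / 2)
  obtain ⟨m, hm, hm'⟩ := hpow (p / 2)
  have hksq : ∀ z ∈ ball (0:ℂ) 1, ‖k z‖ ^ 2 = ‖h z‖ := fun z hz => by
    rw [hk' z hz, ← Real.rpow_mul_natCast (norm_nonneg _)]
    norm_num
  have hmsq : ∀ z ∈ ball (0:ℂ) 1, ‖m z‖ ^ 2 = ‖h z‖ ^ p := fun z hz => by
    rw [hm' z hz, ← Real.rpow_mul_natCast (norm_nonneg _)]
    norm_num
  have hk0 : ∀ z ∈ ball (0:ℂ) 1, k z ≠ 0 := fun z hz hzero => by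
    have := hksq z hz
    rw [hzero, norm_zero, zero_pow two_ne_zero] at this
    exact hne z hz (norm_eq_zero.1 this.symm)
  have hT1 : ∀ z ∈ ball (0:ℂ) 1, ‖T.eval z‖ ≤ ‖h z‖ := fun z hz =>
    hle z (ball_subset_closedBall hz)
  refine ⟨fun z => T.eval z / k z, k, m, HardySqLE.mono (HardySqLE.of_sq_norm_le
      (T.differentiable.differentiableOn.div hk hk0) hc.norm fun z hz => ?_) hmean1,
    HardySqLE.mono (HardySqLE.of_sq_norm_le hk hc.norm fun z hz => (hksq z hz).le) hmean1,
    HardySqLE.mono (HardySqLE.of_sq_norm_le hm (hc.norm.rpow_const fun _ => Or.inr hp0)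
      fun z hz => (hmsq z hz).le) hmeanp, fun z hz => ⟨?_, ?_⟩⟩
  · rw [Pi.div_apply, norm_div, div_pow, hksq z hz]
    refine div_le_of_le_mul₀ (norm_nonneg _) (norm_nonneg _) ?_
    rw [← sq]
    exact pow_le_pow_left₀ (norm_nonneg _) (hT1 z hz) 2
  · exact (div_mul_cancel₀ _ (hk0 z hz)).symm
  · rw [hmsq z hz]
    exact Real.rpow_le_rpow (norm_nonneg _) (hT1 z hz) hp0

lemma HasHardyFactors.of_tendsto {p M : ℝ} (hp : 0 ≤ p) {T : ℕ → ℂ → ℂ} {g : ℂ → ℂ}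
    (hT : ∀ n, HasHardyFactors p M (T n))
    (hlim : ∀ z ∈ ball (0:ℂ) 1, Tendsto (fun n => T n z) atTop (𝓝 (g z))) :
    HasHardyFactors p M g := by
  choose f k m hf hk hm hfac using hT
  set U : Ultrafilter ℕ := Ultrafilter.of atTop
  obtain ⟨f', hf', hf''⟩ := exists_tendsto_hardySqLE U hf
  obtain ⟨k', hk', hk''⟩ := exists_tendsto_hardySqLE U hk
  obtain ⟨m', hm', hm''⟩ := exists_tendsto_hardySqLE U hm
  refine ⟨f', k', m', hf', hk', hm', fun z hz => ?_⟩
  have hg := (hlim z hz).mono_left (Ultrafilter.of_le atTop)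
  refine ⟨tendsto_nhds_unique hg (((hf'' z hz).mul (hk'' z hz)).congr fun n => ?_), ?_⟩
  · exact (hfac n z hz).1.symm
  · exact le_of_tendsto_of_tendsto (hg.norm.rpow_const (Or.inr hp)) ((hm'' z hz).norm.pow 2)
      (Eventually.of_forall fun n => (hfac n z hz).2)

lemma MemHp.exists_angleMean_le {p : ℝ} (hp : 1 ≤ p) {g : ℂ → ℂ} (hg : MemHp p g) :
    ∃ M, ∀ r ∈ Ioo (0:ℝ) 1,
      angleMean (fun θ => ‖g ((r : ℂ) * exp ((θ : ℂ) * I))‖ ^ p) ≤ M := by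
  obtain ⟨B, hB⟩ := hg.2
  refine ⟨B ^ p, fun r hr => ?_⟩
  have h0 : 0 ≤ angleMean fun θ => ‖g ((r : ℂ) * exp ((θ : ℂ) * I))‖ ^ p :=
    angleMean_nonneg fun θ => by positivity
  have h : (angleMean fun θ => ‖g ((r : ℂ) * exp ((θ : ℂ) * I))‖ ^ p) ^ (1 / p) ≤ B :=
    hB ⟨⟨r, hr⟩, rfl⟩
  have := Real.rpow_le_rpow (by positivity) h (zero_le_one.trans hp)
  rwa [one_div, Real.rpow_inv_rpow h0 (by linarith)] at this

lemma differentiableOn_dilation {g : ℂ → ℂ} (hg : DifferentiableOn ℂ g (ball 0 1)) {t : ℝ}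
    (ht : t ∈ Ioo (0:ℝ) 1) : DifferentiableOn ℂ (fun z => g ((t : ℂ) * z)) (ball 0 t⁻¹) := by
  refine hg.comp (by fun_prop) fun z hz => ?_
  rw [mem_ball_zero_iff] at hz ⊢
  rw [norm_mul, norm_real, Real.norm_of_nonneg ht.1.le]
  calc t * ‖z‖ < t * t⁻¹ := mul_lt_mul_of_pos_left hz ht.1
    _ = 1 := mul_inv_cancel₀ ht.1.ne'

lemma MemHp.exists_hasHardyFactors {p : ℝ} (hp : 1 ≤ p) {g : ℂ → ℂ} (hg : MemHp p g) :
    ∃ M, HasHardyFactors p M g := by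
  have hp0 : 0 ≤ p := zero_le_one.trans hp
  obtain ⟨M, hM⟩ := hg.exists_angleMean_le hp
  have hR : ∀ n : ℕ, 1 - 1 / ((n : ℝ) + 2) ∈ Ioo (0:ℝ) 1 := fun n => by
    have h2 : (1:ℝ) < n + 2 := by linarith [n.cast_nonneg (α := ℝ)]
    have := (div_lt_one (zero_lt_one.trans h2)).2 h2
    have : 0 < 1 / ((n : ℝ) + 2) := by positivity
    constructor <;> linarith
  set R : ℕ → ℝ := fun n => 1 - 1 / ((n : ℝ) + 2) with hRdef
  have happrox := fun n : ℕ => exists_polynomial_ne_zero_near_of_differentiableOn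
    ((one_lt_inv₀ (hR n).1).2 (hR n).2) (differentiableOn_dilation hg.1 (hR n))
    (Nat.one_div_pos_of_nat (α := ℝ) (n := n))
  choose T hT0 hT using happrox
  have hRlim : Tendsto R atTop (𝓝 1) := by
    have := (tendsto_const_div_atTop_nhds_zero_nat (1:ℝ)).comp (tendsto_add_atTop_nat 2)
    have := this.const_sub 1
    simpa [hRdef, Function.comp_def] using this
  refine ⟨2 ^ p * (1 + M), HasHardyFactors.of_tendsto hp0
    (fun n => hasHardyFactors_polynomial hp (hT0 n) ?_) fun z hz => ?_⟩
  · have hgc := (continuous_comp_circle hg.1.continuousOn (hR n)).norm.rpow_const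
      (p := p) fun _ => Or.inr hp0
    calc _ ≤ angleMean fun θ => 2 ^ p * (1 + ‖g ((R n : ℂ) * exp ((θ : ℂ) * I))‖ ^ p) := by
          refine angleMean_mono (Continuous.rpow_const (by fun_prop) fun _ => Or.inr hp0)
            (by fun_prop) fun θ => ?_
          have h1 : ‖(T n).eval (exp ((θ : ℂ) * I))‖ ≤
              1 + ‖g ((R n : ℂ) * exp ((θ : ℂ) * I))‖ := by
            have h2 := hT n (exp ((θ : ℂ) * I)) (by simp [norm_exp_ofReal_mul_I])
            have h3 := norm_sub_norm_le ((T n).eval (exp ((θ : ℂ) * I)))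
              (g ((R n : ℂ) * exp ((θ : ℂ) * I)))
            have h4 : 1 / ((n : ℝ) + 1) ≤ 1 :=
              (div_le_one (by positivity)).2 (by linarith [n.cast_nonneg (α := ℝ)])
            linarith
          refine (Real.rpow_le_rpow (norm_nonneg _) h1 hp0).trans ?_
          simpa using add_rpow_le_two_rpow_mul zero_le_one
            (norm_nonneg (g ((R n : ℂ) * exp ((θ : ℂ) * I)))) hp0
      _ ≤ _ := by
          rw [angleMean_const_mul, angleMean_add continuous_const hgc, angleMean_const]
          gcongr
          exact hM _ (hR n)
  · have hgz : Tendsto (fun n => g ((R n : ℂ) * z)) atTop (𝓝 (g z)) := by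
      have hca := (hg.1.continuousOn.continuousAt (isOpen_ball.mem_nhds hz)).tendsto
      refine hca.comp ?_
      have := ((continuous_ofReal.tendsto 1).comp hRlim).mul_const z
      simpa [Function.comp_def] using this
    have h0 : Tendsto (fun n => (T n).eval z - g ((R n : ℂ) * z)) atTop (𝓝 0) :=
      squeeze_zero_norm (fun n => hT n z (ball_subset_closedBall hz))
        tendsto_one_div_add_atTop_nhds_zero_nat
    simpa using h0.add hgz

lemma HardySqLE.nonneg {M : ℝ} {f : ℂ → ℂ} (h : HardySqLE M f) : 0 ≤ M := by
  obtain ⟨a, -, hM⟩ := h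
  simpa using hM 0

lemma HardySqLE.exists_bound_circle {M : ℝ} {f : ℂ → ℂ} (h : HardySqLE M f) {r : ℝ}
    (hr : r ∈ Ioo (0:ℝ) 1) : ∃ A, ∀ θ : ℝ, ‖f ((r : ℂ) * exp ((θ : ℂ) * I))‖ ≤ A := by
  obtain ⟨a, ha, -⟩ := h
  have hs := summable_norm_coeff_mul_pow ha hr.1.le hr.2
  refine ⟨∑' n, ‖a n‖ * r ^ n, fun θ => ?_⟩
  rw [← (hasSum_circle ha hr.1.le hr.2 θ).tsum_eq]
  exact tsum_of_norm_bounded hs.hasSum fun n => by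
    simp [norm_exp_ofReal_mul_I, abs_of_nonneg hr.1.le]

lemma mul_le_weighted_sq {t : ℝ} (ht : 0 < t) (x y : ℝ) : x * y ≤ t * x ^ 2 + t⁻¹ * y ^ 2 := by
  have h : t⁻¹ * (t * x - y) ^ 2 = t * x ^ 2 - 2 * (x * y) + t⁻¹ * y ^ 2 := by
    field_simp
    ring
  have h2 : t⁻¹ * (t * x + y) ^ 2 = t * x ^ 2 + 2 * (x * y) + t⁻¹ * y ^ 2 := by
    field_simp
    ring
  have := mul_nonneg (inv_pos.2 ht).le (sq_nonneg (t * x - y))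
  have := mul_nonneg (inv_pos.2 ht).le (sq_nonneg (t * x + y))
  rcases le_total 0 (x * y) with h0 | h0 <;> linarith

/-- The dilations of a product of two `H²` functions are Cauchy in mean. -/
lemma exists_dilation_cauchy_mul {M : ℝ} {f k : ℂ → ℂ} (hf : HardySqLE M f) (hk : HardySqLE M k)
    {δ : ℝ} (hδ : 0 < δ) : ∃ ρ ∈ Ioo (0:ℝ) 1, ∀ r ∈ Ico ρ 1, ∀ s ∈ Ico ρ 1,
      angleMean (fun θ => ‖f ((r : ℂ) * exp ((θ : ℂ) * I)) * k ((r : ℂ) * exp ((θ : ℂ) * I)) -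
        f ((s : ℂ) * exp ((θ : ℂ) * I)) * k ((s : ℂ) * exp ((θ : ℂ) * I))‖) ≤ δ := by
  have hM := hf.nonneg
  set t : ℝ := δ / (4 * (1 + M)) with ht
  have ht0 : 0 < t := by positivity
  obtain ⟨ρ₁, h₁, hρ₁⟩ := hf.exists_dilation_cauchy (δ := t * (δ / 4)) (by positivity)
  obtain ⟨ρ₂, h₂, hρ₂⟩ := hk.exists_dilation_cauchy (δ := t * (δ / 4)) (by positivity)
  refine ⟨max ρ₁ ρ₂, ⟨lt_max_of_lt_left h₁.1, max_lt h₁.2 h₂.2⟩, fun r hr s hs => ?_⟩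
  have hr' : r ∈ Ioo (0:ℝ) 1 := ⟨h₁.1.trans_le ((le_max_left _ _).trans hr.1), hr.2⟩
  have hs' : s ∈ Ioo (0:ℝ) 1 := ⟨h₁.1.trans_le ((le_max_left _ _).trans hs.1), hs.2⟩
  have h3 := hρ₁ r ⟨(le_max_left _ _).trans hr.1, hr.2⟩ s ⟨(le_max_left _ _).trans hs.1, hs.2⟩
  have h4 := hρ₂ r ⟨(le_max_right _ _).trans hr.1, hr.2⟩ s ⟨(le_max_right _ _).trans hs.1, hs.2⟩
  have hfr := hf.continuous_circle hr'
  have hfs := hf.continuous_circle hs'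
  have hkr := hk.continuous_circle hr'
  have hks := hk.continuous_circle hs'
  have h5 := hf.angleMean_le hr'
  have h6 := hk.angleMean_le hs'
  generalize hfR : (fun θ : ℝ => f ((r : ℂ) * exp ((θ : ℂ) * I))) = fR at hfr
  generalize hfS : (fun θ : ℝ => f ((s : ℂ) * exp ((θ : ℂ) * I))) = fS at hfs
  generalize hkR : (fun θ : ℝ => k ((r : ℂ) * exp ((θ : ℂ) * I))) = kR at hkr
  generalize hkS : (fun θ : ℝ => k ((s : ℂ) * exp ((θ : ℂ) * I))) = kS at hks
  simp only [fun θ => congrFun hfR θ, fun θ => congrFun hfS θ, fun θ => congrFun hkR θ,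
    fun θ => congrFun hkS θ] at h3 h4 h5 h6 ⊢
  calc _ ≤ angleMean fun θ => t * (‖fR θ‖ ^ 2 + ‖kS θ‖ ^ 2) +
        t⁻¹ * (‖kR θ - kS θ‖ ^ 2 + ‖fR θ - fS θ‖ ^ 2) := by
        refine angleMean_mono (by fun_prop) (by fun_prop) fun θ => ?_
        calc ‖fR θ * kR θ - fS θ * kS θ‖
            = ‖fR θ * (kR θ - kS θ) + kS θ * (fR θ - fS θ)‖ := by congr 1; ring
          _ ≤ ‖fR θ‖ * ‖kR θ - kS θ‖ + ‖kS θ‖ * ‖fR θ - fS θ‖ := by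
              simpa only [norm_mul] using
                norm_add_le (fR θ * (kR θ - kS θ)) (kS θ * (fR θ - fS θ))
          _ ≤ _ := by
              have e1 := mul_le_weighted_sq ht0 ‖fR θ‖ ‖kR θ - kS θ‖
              have e2 := mul_le_weighted_sq ht0 ‖kS θ‖ ‖fR θ - fS θ‖
              linarith
    _ ≤ t * (M + M) + t⁻¹ * (t * (δ / 4) + t * (δ / 4)) := by
        rw [angleMean_add (by fun_prop) (by fun_prop), angleMean_const_mul, angleMean_const_mul,
          angleMean_add (by fun_prop) (by fun_prop), angleMean_add (by fun_prop) (by fun_prop)]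
        gcongr
    _ ≤ δ := by
        have e1 : t⁻¹ * (t * (δ / 4) + t * (δ / 4)) = δ / 2 := by field_simp; ring
        have e2 : t * (4 * (1 + M)) = δ := by rw [ht]; field_simp
        nlinarith

lemma rpow_le_of_le_add_const {p : ℝ} (hp : 1 ≤ p) {B : ℝ} (hB : 0 ≤ B) :
    ∃ C, 0 ≤ C ∧ ∀ D E : ℝ, 0 ≤ D → 0 ≤ E → D ^ p ≤ E + B → D ^ p ≤ 2 * E + C * D := by
  have hp0 : 0 < p := zero_lt_one.trans_le hp
  set L : ℝ := (2 * B) ^ p⁻¹ with hL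
  have hL0 : 0 ≤ L := by positivity
  have hLp : L ^ p = 2 * B := Real.rpow_inv_rpow (by positivity) hp0.ne'
  refine ⟨L ^ (p - 1), by positivity, fun D E hD hE h => ?_⟩
  rcases le_total D L with h1 | h1
  · have h2 : D ^ p = D ^ (p - 1) * D := by
      have := Real.rpow_add_of_nonneg hD (sub_nonneg.2 hp) zero_le_one
      rwa [sub_add_cancel, Real.rpow_one] at this
    have h3 := Real.rpow_le_rpow hD h1 (sub_nonneg.2 hp)
    rw [h2]
    nlinarith
  · have h2 := Real.rpow_le_rpow hL0 h1 hp0.le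
    have : 0 ≤ L ^ (p - 1) * D := by positivity
    linarith

lemma sq_norm_le_two_mul (a b : ℂ) : ‖a‖ ^ 2 ≤ 2 * ‖a - b‖ ^ 2 + 2 * ‖b‖ ^ 2 := by
  have h : ‖a‖ ≤ ‖a - b‖ + ‖b‖ := by simpa using norm_add_le (a - b) b
  have h2 := pow_le_pow_left₀ (norm_nonneg _) h 2
  nlinarith [sq_nonneg (‖a - b‖ - ‖b‖)]

lemma HasHardyFactors.exists_dilation_cauchy {p M : ℝ} (hp : 1 ≤ p) {g : ℂ → ℂ}
    (hg : ContinuousOn g (ball 0 1)) (hfac : HasHardyFactors p M g) {δ : ℝ} (hδ : 0 < δ) :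
    ∃ ρ ∈ Ioo (0:ℝ) 1, ∀ r ∈ Ico ρ 1, ∀ s ∈ Ico ρ 1,
      angleMean (fun θ => ‖g ((r : ℂ) * exp ((θ : ℂ) * I)) -
        g ((s : ℂ) * exp ((θ : ℂ) * I))‖ ^ p) ≤ δ := by
  have hp0 : 0 ≤ p := zero_le_one.trans hp
  obtain ⟨f, k, m, hf, hk, hm, hfac⟩ := hfac
  obtain ⟨ρ₁, h₁, hρ₁⟩ := hm.exists_dilation_cauchy (δ := δ / (16 * 2 ^ p)) (by positivity)
  obtain ⟨A, hA⟩ := hm.exists_bound_circle h₁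
  obtain ⟨C, hC0, hC⟩ := rpow_le_of_le_add_const hp (B := 2 ^ p * (4 * A ^ 2)) (by positivity)
  obtain ⟨ρ₂, h₂, hρ₂⟩ := exists_dilation_cauchy_mul hf hk (δ := δ / (2 * (C + 1)))
    (by positivity)
  refine ⟨max ρ₁ ρ₂, ⟨lt_max_of_lt_left h₁.1, max_lt h₁.2 h₂.2⟩, fun r hr s hs => ?_⟩
  have hball : ∀ {x : ℝ}, x ∈ Ioo (0:ℝ) 1 → ∀ θ : ℝ,
      (x : ℂ) * exp ((θ : ℂ) * I) ∈ ball (0:ℂ) 1 := fun {x} hx θ => by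
    rw [mem_ball_zero_iff, norm_circle hx.1.le]
    exact hx.2
  have hr' : r ∈ Ioo (0:ℝ) 1 := ⟨h₁.1.trans_le ((le_max_left _ _).trans hr.1), hr.2⟩
  have hs' : s ∈ Ioo (0:ℝ) 1 := ⟨h₁.1.trans_le ((le_max_left _ _).trans hs.1), hs.2⟩
  have h3 := hρ₁ r ⟨(le_max_left _ _).trans hr.1, hr.2⟩ ρ₁ ⟨le_rfl, h₁.2⟩
  have h4 := hρ₁ s ⟨(le_max_left _ _).trans hs.1, hs.2⟩ ρ₁ ⟨le_rfl, h₁.2⟩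
  have h5 := hρ₂ r ⟨(le_max_right _ _).trans hr.1, hr.2⟩ s ⟨(le_max_right _ _).trans hs.1, hs.2⟩
  simp only [← (hfac _ (hball hr' _)).1, ← (hfac _ (hball hs' _)).1] at h5
  have hgm : ∀ x ∈ Ioo (0:ℝ) 1, ∀ θ : ℝ, ‖g ((x : ℂ) * exp ((θ : ℂ) * I))‖ ^ p ≤
      2 * ‖m ((x : ℂ) * exp ((θ : ℂ) * I)) - m ((ρ₁ : ℂ) * exp ((θ : ℂ) * I))‖ ^ 2 +
        2 * A ^ 2 := fun x hx θ => by
    have e1 := (hfac _ (hball hx θ)).2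
    have e2 := sq_norm_le_two_mul (m ((x : ℂ) * exp ((θ : ℂ) * I)))
      (m ((ρ₁ : ℂ) * exp ((θ : ℂ) * I)))
    have e3 := pow_le_pow_left₀ (norm_nonneg _) (hA θ) 2
    linarith
  have hgr := continuous_comp_circle hg hr'
  have hgs := continuous_comp_circle hg hs'
  have hmr := hm.continuous_circle hr'
  have hms := hm.continuous_circle hs'
  have hmρ := hm.continuous_circle h₁
  have hgmr := hgm r hr'
  have hgms := hgm s hs'
  generalize hgR : (fun θ : ℝ => g ((r : ℂ) * exp ((θ : ℂ) * I))) = gR at hgr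
  generalize hgS : (fun θ : ℝ => g ((s : ℂ) * exp ((θ : ℂ) * I))) = gS at hgs
  generalize hmR : (fun θ : ℝ => m ((r : ℂ) * exp ((θ : ℂ) * I))) = mR at hmr
  generalize hmS : (fun θ : ℝ => m ((s : ℂ) * exp ((θ : ℂ) * I))) = mS at hms
  generalize hmT : (fun θ : ℝ => m ((ρ₁ : ℂ) * exp ((θ : ℂ) * I))) = mT at hmρ
  simp only [fun θ => congrFun hgR θ, fun θ => congrFun hgS θ, fun θ => congrFun hmR θ,
    fun θ => congrFun hmS θ, fun θ => congrFun hmT θ] at h3 h4 h5 hgmr hgms ⊢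
  calc _ ≤ angleMean fun θ => 2 * (2 ^ p * (2 * (‖mR θ - mT θ‖ ^ 2 + ‖mS θ - mT θ‖ ^ 2))) +
        C * ‖gR θ - gS θ‖ := by
        refine angleMean_mono ((hgr.sub hgs).norm.rpow_const fun _ => Or.inr hp0)
          (by fun_prop) fun θ => hC _ _ (norm_nonneg _) (by positivity) ?_
        calc ‖gR θ - gS θ‖ ^ p ≤ (‖gR θ‖ + ‖gS θ‖) ^ p :=
              Real.rpow_le_rpow (norm_nonneg _) (norm_sub_le _ _) hp0
          _ ≤ 2 ^ p * (‖gR θ‖ ^ p + ‖gS θ‖ ^ p) :=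
              add_rpow_le_two_rpow_mul (norm_nonneg _) (norm_nonneg _) hp0
          _ ≤ 2 ^ p * ((2 * ‖mR θ - mT θ‖ ^ 2 + 2 * A ^ 2) +
                (2 * ‖mS θ - mT θ‖ ^ 2 + 2 * A ^ 2)) := by
              gcongr
              exacts [hgmr θ, hgms θ]
          _ = _ := by ring
    _ ≤ 2 * (2 ^ p * (2 * (δ / (16 * 2 ^ p) + δ / (16 * 2 ^ p)))) +
        C * (δ / (2 * (C + 1))) := by
        rw [angleMean_add (by fun_prop) (by fun_prop), angleMean_const_mul, angleMean_const_mul,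
          angleMean_const_mul, angleMean_const_mul, angleMean_add (by fun_prop) (by fun_prop)]
        gcongr
    _ ≤ δ := by
        have e1 : 2 * ((2:ℝ) ^ p * (2 * (δ / (16 * 2 ^ p) + δ / (16 * 2 ^ p)))) = δ / 2 := by
          field_simp
          ring
        have e2 : C * (δ / (2 * (C + 1))) ≤ δ / 2 := by
          rw [mul_div_assoc', div_le_div_iff₀ (by positivity) two_pos]
          nlinarith
        linarith

/-- Polynomials are dense in `H^p`. -/
lemma MemHp.exists_polynomial_near {p : ℝ} (hp : 1 ≤ p) {g : ℂ → ℂ} (hg : MemHp p g) {δ : ℝ}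
    (hδ : 0 < δ) : ∃ P : Polynomial ℂ, ∀ r ∈ Ioo (0:ℝ) 1,
      angleMean (fun θ => ‖P.eval ((r : ℂ) * exp ((θ : ℂ) * I)) -
        g ((r : ℂ) * exp ((θ : ℂ) * I))‖ ^ p) ≤ δ := by
  have hp0 : 0 < p := zero_lt_one.trans_le hp
  obtain ⟨M, hM⟩ := hg.exists_hasHardyFactors hp
  have hgc := hg.1.continuousOn
  set η : ℝ := δ / (2 * 2 ^ p) with hη
  have hη0 : 0 < η := by positivity
  obtain ⟨ρ, hρ, hcau⟩ := hM.exists_dilation_cauchy hp hgc hη0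
  have hsq0 : 0 < √ρ := Real.sqrt_pos.2 hρ.1
  have hsq1 : √ρ < 1 := by rw [Real.sqrt_lt' one_pos]; simpa using hρ.2
  set κ : ℝ := η ^ p⁻¹ with hκ
  have hκ0 : 0 < κ := by positivity
  have hκp : κ ^ p = η := Real.rpow_inv_rpow hη0.le hp0.ne'
  obtain ⟨τ, hτ, hunif⟩ := Metric.uniformContinuousOn_iff.1
    ((isCompact_closedBall (0:ℂ) (√ρ)).uniformContinuousOn_of_continuous
      (hgc.mono (closedBall_subset_ball hsq1))) κ hκ0
  set t : ℝ := max (√ρ) (1 - τ / 2) with ht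
  have htI : t ∈ Ioo (0:ℝ) 1 := ⟨lt_max_of_lt_left hsq0, max_lt hsq1 (by linarith)⟩
  obtain ⟨P, hP⟩ := exists_polynomial_near_of_differentiableOn ((one_lt_inv₀ htI.1).2 htI.2)
    (differentiableOn_dilation hg.1 htI) hκ0
  have hcast : ∀ (r θ : ℝ), (t : ℂ) * ((r : ℂ) * exp ((θ : ℂ) * I)) =
      ((t * r : ℝ) : ℂ) * exp ((θ : ℂ) * I) := fun r θ => by push_cast; ring
  refine ⟨P, fun r hr => ?_⟩
  have htr : t * r ∈ Ioo (0:ℝ) 1 :=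
    ⟨mul_pos htI.1 hr.1, mul_lt_one_of_nonneg_of_lt_one_left htI.1.le htI.2 hr.2.le⟩
  have hgr := continuous_comp_circle hgc hr
  have hgt := continuous_comp_circle hgc htr
  have hdiff : Continuous fun θ : ℝ => ‖g (((t * r : ℝ) : ℂ) * exp ((θ : ℂ) * I)) -
      g ((r : ℂ) * exp ((θ : ℂ) * I))‖ ^ p :=
    (hgt.sub hgr).norm.rpow_const fun _ => Or.inr hp0.le
  have hPg : Continuous fun θ : ℝ => ‖P.eval ((r : ℂ) * exp ((θ : ℂ) * I)) -
      g ((r : ℂ) * exp ((θ : ℂ) * I))‖ ^ p :=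
    (Continuous.sub (by fun_prop) hgr).norm.rpow_const fun _ => Or.inr hp0.le
  have hclose : angleMean (fun θ => ‖g (((t * r : ℝ) : ℂ) * exp ((θ : ℂ) * I)) -
      g ((r : ℂ) * exp ((θ : ℂ) * I))‖ ^ p) ≤ η := by
    rcases le_or_gt (√ρ) r with h | h
    · refine hcau _ ⟨?_, htr.2⟩ _ ⟨?_, hr.2⟩
      · calc ρ = √ρ * √ρ := (Real.mul_self_sqrt hρ.1.le).symm
          _ ≤ t * r := mul_le_mul (le_max_left _ _) h hsq0.le htI.1.le
      · refine le_trans ?_ h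
        exact Real.le_sqrt_of_sq_le (by nlinarith [hρ.1, hρ.2])
    · refine angleMean_le_const hdiff fun θ => ?_
      rw [← hκp]
      refine Real.rpow_le_rpow (norm_nonneg _) ?_ hp0.le
      rw [← dist_eq_norm]
      refine (hunif _ ?_ _ ?_ ?_).le
      · rw [mem_closedBall_zero_iff, norm_circle htr.1.le]
        nlinarith [htI.2, hr.1]
      · rw [mem_closedBall_zero_iff, norm_circle hr.1.le]
        exact h.le
      · rw [dist_eq_norm, ← hcast, ← sub_one_mul, norm_mul, norm_circle hr.1.le,
          show (t : ℂ) - 1 = ((t - 1 : ℝ) : ℂ) by push_cast; rfl, norm_real, Real.norm_eq_abs,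
          abs_of_neg (by linarith [htI.2])]
        have : 1 - τ / 2 ≤ t := le_max_right _ _
        nlinarith [htI.2, hr.1, hr.2]
  calc _ ≤ angleMean fun θ => 2 ^ p * (η + ‖g (((t * r : ℝ) : ℂ) * exp ((θ : ℂ) * I)) -
        g ((r : ℂ) * exp ((θ : ℂ) * I))‖ ^ p) := by
        refine angleMean_mono hPg
          (continuous_const.mul (continuous_const.add hdiff)) fun θ => ?_
        have h1 := hP ((r : ℂ) * exp ((θ : ℂ) * I))
          (by rw [mem_closedBall_zero_iff, norm_circle hr.1.le]; exact hr.2.le)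
        rw [hcast] at h1
        have h2 := norm_sub_le_norm_sub_add_norm_sub (P.eval ((r : ℂ) * exp ((θ : ℂ) * I)))
          (g (((t * r : ℝ) : ℂ) * exp ((θ : ℂ) * I))) (g ((r : ℂ) * exp ((θ : ℂ) * I)))
        refine (Real.rpow_le_rpow (norm_nonneg _) (h2.trans (by gcongr)) hp0.le).trans
          ((add_rpow_le_two_rpow_mul hκ0.le (norm_nonneg _) hp0.le).trans_eq ?_)
        rw [hκp]
    _ ≤ 2 ^ p * (η + η) := by
        rw [angleMean_const_mul, angleMean_add continuous_const hdiff, angleMean_const]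
        gcongr
    _ = δ := by
        rw [hη]
        field_simp
        ring
/-- Real parts of polynomials are uniformly dense in the real continuous functions on the unit
circle. -/
lemma exists_polynomial_re_near {u : ℂ → ℝ} (hu : Continuous u) {η : ℝ} (hη : 0 < η) :
    ∃ F : Polynomial ℂ, (F.eval 0).im = 0 ∧ ∀ z : ℂ, ‖z‖ = 1 → |(F.eval z).re - u z| ≤ η := by
  have hspan : ∀ t ∈ Submodule.span ℂ (range (fourier (T := (1:ℝ)))), ∃ F G : Polynomial ℂ,
      ∀ x : AddCircle (1:ℝ), t x = F.eval (x.toCircle : ℂ) +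
        (starRingEnd ℂ) (G.eval (x.toCircle : ℂ)) := by
    intro t ht
    induction ht using Submodule.span_induction with
    | mem t ht =>
      obtain ⟨n, rfl⟩ := ht
      rcases Int.eq_nat_or_neg n with ⟨m, rfl | rfl⟩
      · exact ⟨X ^ m, 0, fun x => by simp [fourier_apply, AddCircle.toCircle_nsmul]⟩
      · exact ⟨0, X ^ m, fun x => by
          rw [fourier_neg]; simp [fourier_apply, AddCircle.toCircle_nsmul]⟩
    | zero => exact ⟨0, 0, fun x => by simp⟩
    | add t s _ _ ht hs =>
      obtain ⟨F, G, h⟩ := ht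
      obtain ⟨F', G', h'⟩ := hs
      exact ⟨F + F', G + G', fun x => by simp [h, h']; ring⟩
    | smul c t _ ht =>
      obtain ⟨F, G, h⟩ := ht
      exact ⟨C c * F, C ((starRingEnd ℂ) c) * G, fun x => by simp [h]; ring⟩
  have hf : Continuous fun x : AddCircle (1:ℝ) => ((u (x.toCircle : ℂ) : ℝ) : ℂ) :=
    continuous_ofReal.comp (hu.comp (continuous_subtype_val.comp AddCircle.continuous_toCircle))
  have hmem : (⟨_, hf⟩ : C(AddCircle (1:ℝ), ℂ)) ∈
      (Submodule.span ℂ (range (fourier (T := (1:ℝ))))).topologicalClosure := by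
    rw [span_fourier_closure_eq_top]
    trivial
  obtain ⟨t, ht, htη⟩ := Metric.mem_closure_iff.1 hmem η hη
  obtain ⟨F, G, hFG⟩ := hspan t ht
  refine ⟨F + G - C ((((F.eval 0 + G.eval 0).im : ℝ) : ℂ) * I), by simp, fun z hz => ?_⟩
  obtain ⟨x, hx⟩ := (AddCircle.homeomorphCircle (T := 1) one_ne_zero).surjective
    ⟨z, by simpa [Submonoid.unitSphere] using hz⟩
  have hxz : (x.toCircle : ℂ) = z := by
    rw [← AddCircle.homeomorphCircle_apply one_ne_zero, hx]
  have h1 := (ContinuousMap.dist_lt_iff hη).1 htη x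
  rw [dist_comm, dist_eq_norm] at h1
  have h2 := (abs_re_le_norm _).trans h1.le
  simpa [hFG, hxz] using h2

lemma exists_continuous_angleMean_le {K : Set ℂ} (hK : IsClosed K) (hKm : arcMeasure K = 0)
    {η : ℝ} (hη : 0 < η) : ∃ v : ℂ → ℝ, Continuous v ∧ (∀ z, v z ∈ Icc (0:ℝ) 1) ∧
      (∀ z ∈ K, v z = 1) ∧ angleMean (fun θ => v (exp ((θ : ℂ) * I))) ≤ η := by
  rcases K.eq_empty_or_nonempty with rfl | hne
  · exact ⟨fun _ => 0, continuous_const, by simp, by simp, by simpa [angleMean_const] using hη.le⟩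
  set w : ℂ → ℝ := fun z => (1 + infDist z K)⁻¹ with hw
  have hpos : ∀ z, 0 < 1 + infDist z K := fun z => by linarith [infDist_nonneg (x := z) (s := K)]
  have hwc : Continuous w := (continuous_const.add (continuous_infDist_pt K)).inv₀
    fun z => (hpos z).ne'
  have hw0 : ∀ z, 0 ≤ w z := fun z => (inv_pos.2 (hpos z)).le
  have hw1 : ∀ z, w z ≤ 1 := fun z =>
    inv_le_one_of_one_le₀ (by linarith [infDist_nonneg (x := z) (s := K)])
  have hwK : ∀ z ∈ K, w z = 1 := fun z hz => by simp [hw, infDist_zero_of_mem hz]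
  have hwlt : ∀ z ∉ K, w z < 1 := fun z hz => by
    have := (hK.notMem_iff_infDist_pos hne).1 hz
    exact inv_lt_one_of_one_lt₀ (by linarith)
  have hae : ∀ᵐ θ : ℝ, θ ∈ uIoc 0 (2 * Real.pi) → exp ((θ : ℂ) * I) ∉ K := by
    have h2 : ∀ᵐ θ : ℝ, θ ≠ 2 * Real.pi := by
      simp [ae_iff]
    have h1 : ∀ᵐ θ : ℝ, ¬ (θ ∈ Ico (0:ℝ) (2 * Real.pi) ∧ exp ((θ : ℂ) * I) ∈ K) := by
      rw [ae_iff]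
      simpa [arcMeasure, and_assoc] using hKm
    filter_upwards [h1, h2] with θ h1 h2 hθ hmem
    rw [uIoc_of_le Real.two_pi_pos.le] at hθ
    exact h1 ⟨⟨hθ.1.le, lt_of_le_of_ne hθ.2 h2⟩, hmem⟩
  have hlim : Tendsto (fun n : ℕ => ∫ θ in (0:ℝ)..(2 * Real.pi), w (exp ((θ : ℂ) * I)) ^ n) atTop
      (𝓝 (∫ _ in (0:ℝ)..(2 * Real.pi), (0:ℝ))) := by
    refine intervalIntegral.tendsto_integral_filter_of_dominated_convergence (fun _ => 1)
      (Eventually.of_forall fun n => ?_) (Eventually.of_forall fun n =>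
        Eventually.of_forall fun θ _ => ?_) intervalIntegrable_const ?_
    · exact Continuous.aestronglyMeasurable (by fun_prop)
    · rw [Real.norm_eq_abs, abs_of_nonneg (pow_nonneg (hw0 _) _)]
      exact pow_le_one₀ (hw0 _) (hw1 _)
    · filter_upwards [hae] with θ h hθ
      exact tendsto_pow_atTop_nhds_zero_of_lt_one (hw0 _) (hwlt _ (h hθ))
  have hlim' : Tendsto (fun n : ℕ => angleMean fun θ => w (exp ((θ : ℂ) * I)) ^ n) atTop (𝓝 0) := by
    simpa [angleMean] using hlim.const_mul (1 / (2 * Real.pi))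
  obtain ⟨n, hn⟩ := (hlim'.eventually (ge_mem_nhds hη)).exists
  exact ⟨fun z => w z ^ n, hwc.pow n, fun z => ⟨pow_nonneg (hw0 z) n, pow_le_one₀ (hw0 z) (hw1 z)⟩,
    fun z hz => by simp [hwK z hz], hn⟩

lemma angleMean_sq_norm_le_two_mul_sq_re {F : ℂ → ℂ} (hF : Differentiable ℂ F)
    (h0 : (F 0).im = 0) : angleMean (fun θ => ‖F (exp ((θ : ℂ) * I))‖ ^ 2) ≤
      2 * angleMean fun θ => (F (exp ((θ : ℂ) * I))).re ^ 2 := by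
  have hFc := hF.continuous
  have hmean := ((hF.pow 2).diffContOnCl (s := ball 0 |1|)).circleAverage
  have hre := congrArg Complex.re hmean
  have hcm : ∀ θ : ℝ, circleMap 0 1 θ = exp ((θ : ℂ) * I) := fun θ => by simp [circleMap]
  rw [Real.circleAverage_def] at hre
  simp only [hcm, real_smul, re_ofReal_mul] at hre
  have hcont : Continuous fun θ : ℝ => (F ^ 2) (exp ((θ : ℂ) * I)) := by
    simp only [Pi.pow_apply]
    fun_prop
  have hint := intervalIntegral.intervalIntegral_re (𝕜 := ℂ)
    (hcont.intervalIntegrable 0 (2 * Real.pi) (μ := volume))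
  have key : 0 ≤ angleMean fun θ => (F (exp ((θ : ℂ) * I)) ^ 2).re := by
    have : angleMean (fun θ => (F (exp ((θ : ℂ) * I)) ^ 2).re) = (F 0).re ^ 2 := by
      have h2 : ((F 0) ^ 2).re = (F 0).re ^ 2 := by rw [sq, mul_re, h0]; ring
      rw [← h2]
      unfold angleMean
      rw [one_div]
      simp only [Pi.pow_apply] at hint hre
      rw [← hre]
      congr 1
    rw [this]
    positivity
  have h3 := angleMean_add (u := fun θ => ‖F (exp ((θ : ℂ) * I))‖ ^ 2)
    (v := fun θ => (F (exp ((θ : ℂ) * I)) ^ 2).re) (by fun_prop)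
    (continuous_re.comp (by fun_prop))
  have h4 : ∀ z : ℂ, ‖z‖ ^ 2 + (z ^ 2).re = 2 * z.re ^ 2 := fun z => by
    rw [← normSq_eq_norm_sq, normSq_apply, sq z, mul_re]
    ring
  simp only [h4, angleMean_const_mul] at h3
  linarith

lemma exists_polynomial_re_large {K : Set ℂ} (hK : IsClosed K) (hKT : K ⊆ sphere (0:ℂ) 1)
    (hKm : arcMeasure K = 0) {N σ : ℝ} (hN : 0 < N) (hσ : 0 < σ) :
    ∃ F : Polynomial ℂ, (∀ z : ℂ, ‖z‖ = 1 → 0 ≤ (F.eval z).re) ∧ (∀ z ∈ K, N ≤ (F.eval z).re) ∧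
      angleMean (fun θ => ‖F.eval (exp ((θ : ℂ) * I))‖ ^ 2) ≤ σ := by
  obtain ⟨v, hvc, hv, hvK, hvm⟩ := exists_continuous_angleMean_le hK hKm
    (show 0 < σ / (8 * N ^ 2) by positivity)
  have hη : 0 < √(σ / 32) := by positivity
  obtain ⟨F, hF0, hF⟩ := exists_polynomial_re_near
    (u := fun z => N * v z + √(σ / 32)) (by fun_prop) hη
  refine ⟨F, fun z hz => ?_, fun z hz => ?_, ?_⟩
  · have := (abs_le.1 (hF z hz)).1
    nlinarith [mul_nonneg hN.le (hv z).1]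
  · have := (abs_le.1 (hF z (by simpa using hKT hz))).1
    rw [hvK z hz] at this
    linarith
  · refine (angleMean_sq_norm_le_two_mul_sq_re F.differentiable hF0).trans ?_
    have h1 : angleMean (fun θ => (F.eval (exp ((θ : ℂ) * I))).re ^ 2) ≤
        angleMean fun θ => 2 * N ^ 2 * v (exp ((θ : ℂ) * I)) + 8 * (σ / 32) := by
      refine angleMean_mono (by fun_prop) (by fun_prop) fun θ => ?_
      have h2 := abs_le.1 (hF (exp ((θ : ℂ) * I)) (norm_exp_ofReal_mul_I θ))
      have hs : √(σ / 32) ^ 2 = σ / 32 := Real.sq_sqrt (by positivity)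
      obtain ⟨h3, h4⟩ := hv (exp ((θ : ℂ) * I))
      set s := √(σ / 32)
      set y := v (exp ((θ : ℂ) * I))
      have hNy : 0 ≤ N * y := by positivity
      have h5 : (F.eval (exp ((θ : ℂ) * I))).re ^ 2 ≤ (N * y + 2 * s) ^ 2 :=
        pow_le_pow_left₀ (by linarith) (by linarith) 2
      have h6 : N ^ 2 * y ^ 2 ≤ N ^ 2 * y := by gcongr; nlinarith
      nlinarith [sq_nonneg (N * y - 2 * s)]
    rw [angleMean_add (by fun_prop) continuous_const, angleMean_const_mul, angleMean_const] at h1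
    have h7 : 2 * N ^ 2 * angleMean (fun θ => v (exp ((θ : ℂ) * I))) ≤ 2 * N ^ 2 *
      (σ / (8 * N ^ 2)) := by gcongr
    have h8 : 2 * N ^ 2 * (σ / (8 * N ^ 2)) = σ / 4 := by field_simp; ring
    linarith

lemma rpow_le_rpow_add_mul_sq {x τ p : ℝ} (hx0 : 0 ≤ x) (hx2 : x ≤ 2) (hτ : 0 < τ) (hp : 0 ≤ p) :
    x ^ p ≤ τ ^ p + 2 ^ p / τ ^ 2 * x ^ 2 := by
  rcases le_total x τ with h | h
  · have := Real.rpow_le_rpow hx0 h hp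
    have : 0 ≤ 2 ^ p / τ ^ 2 * x ^ 2 := by positivity
    linarith
  · have h1 := Real.rpow_le_rpow hx0 hx2 hp
    have h2 : 0 ≤ τ ^ p := by positivity
    have h3 : 2 ^ p ≤ 2 ^ p / τ ^ 2 * x ^ 2 := by
      rw [div_mul_eq_mul_div, le_div_iff₀ (by positivity)]
      gcongr
    linarith

lemma norm_one_sub_exp_neg_le {w : ℂ} (hw : ‖exp (-w)‖ ≤ 1) :
    ‖1 - exp (-w)‖ ≤ 2 ∧ ‖1 - exp (-w)‖ ≤ 2 * ‖w‖ := by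
  have h2 : ‖1 - exp (-w)‖ ≤ 2 := (norm_sub_le _ _).trans (by rw [norm_one]; linarith)
  refine ⟨h2, ?_⟩
  rcases le_total ‖w‖ 1 with h | h
  · simpa [norm_sub_rev] using norm_exp_sub_one_le (x := -w) (by simpa using h)
  · linarith

/-- A compact null set `K` on the unit circle admits polynomials which are close to `1` on `K`
and small in every Hardy norm. -/
lemma exists_peak_polynomial {K : Set ℂ} (hK : IsClosed K) (hKT : K ⊆ sphere (0:ℂ) 1)
    (hKm : arcMeasure K = 0) {p : ℝ} (hp : 0 < p) {δ : ℝ} (hδ : 0 < δ) :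
    ∃ W : Polynomial ℂ, (∀ z ∈ K, ‖W.eval z - 1‖ ≤ δ) ∧ ‖W.eval 0‖ ≤ δ ∧
      ∀ r ∈ Ioo (0:ℝ) 1, angleMean (fun θ => ‖W.eval ((r : ℂ) * exp ((θ : ℂ) * I))‖ ^ p) ≤ δ := by
  set η : ℝ := δ / (4 * 2 ^ p) with hη
  have hη0 : 0 < η := by positivity
  set τ : ℝ := η ^ p⁻¹ with hτ
  have hτ0 : 0 < τ := by positivity
  have hτp : τ ^ p = η := Real.rpow_inv_rpow hη0.le hp.ne'
  set σ : ℝ := min (δ ^ 2 / 16) (η * τ ^ 2 / (4 * 2 ^ p)) with hσ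
  have hσ0 : 0 < σ := by positivity
  obtain ⟨F, hF0, hFK, hFm⟩ := exists_polynomial_re_large hK hKT hKm
    (show 0 < 2 / δ by positivity) hσ0
  have hexp : ∀ z ∈ closedBall (0:ℂ) 1, ‖exp (-F.eval z)‖ ≤ 1 := fun z hz => by
    refine norm_le_of_forall_mem_frontier_norm_le (U := ball (0:ℂ) 1)
      (f := fun z => exp (-F.eval z)) isBounded_ball
      (Differentiable.diffContOnCl (by fun_prop)) (fun w hw => ?_)
      (by rwa [closure_ball _ one_ne_zero])
    rw [frontier_ball _ one_ne_zero, mem_sphere_zero_iff_norm] at hw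
    rw [norm_exp, Real.exp_le_one_iff, neg_re]
    linarith [hF0 w hw]
  obtain ⟨W, hW⟩ := exists_polynomial_near_of_differentiableOn (R := 2) one_lt_two
    (f := fun z => 1 - exp (-F.eval z)) (Differentiable.differentiableOn (by fun_prop))
    (show 0 < min (δ / 2) τ by positivity)
  have hsq := HardySqLE.of_sq_norm_le (q := fun z => F.eval z) F.differentiable.differentiableOn
    (H := fun z => ‖F.eval z‖ ^ 2) (by fun_prop) fun z _ => le_rfl
  have hsqσ := hsq.mono hFm
  refine ⟨W, fun z hz => ?_, ?_, fun r hr => ?_⟩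
  · have hz1 : z ∈ closedBall (0:ℂ) 1 := sphere_subset_closedBall (hKT hz)
    have h1 := (hW z hz1).trans (min_le_left _ _)
    have h2 : ‖exp (-F.eval z)‖ ≤ δ / 2 := by
      rw [norm_exp, neg_re, Real.exp_neg]
      refine inv_le_of_inv_le₀ (by positivity) ?_
      rw [inv_div]
      exact (hFK z hz).trans (by linarith [Real.add_one_le_exp (F.eval z).re])
    calc ‖W.eval z - 1‖ = ‖(W.eval z - (1 - exp (-F.eval z))) - exp (-F.eval z)‖ := by
          congr 1; ring
      _ ≤ δ / 2 + δ / 2 := (norm_sub_le _ _).trans (add_le_add h1 h2)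
      _ = δ := add_halves δ
  · have h0 : (0:ℂ) ∈ closedBall (0:ℂ) 1 := by simp
    have h1 := (hW 0 h0).trans (min_le_left _ _)
    have h2 := (norm_one_sub_exp_neg_le (hexp 0 h0)).2
    obtain ⟨a, ha, hb⟩ := hsqσ
    have ha0 : F.eval 0 = a 0 := by
      refine (ha 0 (by simp)).unique ?_
      convert! hasSum_ite_eq 0 (a 0) using 2 with n
      rcases eq_or_ne n 0 with rfl | hn <;> simp [*]
    have h3 : ‖F.eval 0‖ ^ 2 ≤ (δ / 4) ^ 2 := by
      have := hb 1
      rw [Finset.sum_range_one, ← ha0] at this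
      refine this.trans ((min_le_left _ _).trans_eq (by ring))
    have h4 := le_of_sq_le_sq h3 (by positivity)
    have h5 := norm_le_norm_add_norm_sub' (W.eval 0) (1 - exp (-F.eval 0))
    linarith
  · have hin : ∀ θ : ℝ, (r : ℂ) * exp ((θ : ℂ) * I) ∈ closedBall (0:ℂ) 1 := fun θ => by
      rw [mem_closedBall_zero_iff, norm_circle hr.1.le]; exact hr.2.le
    have hmean := hsqσ.angleMean_le hr
    calc _ ≤ angleMean fun θ => 2 ^ p * (2 * η + 2 ^ p / τ ^ 2 * 4 *
          ‖F.eval ((r : ℂ) * exp ((θ : ℂ) * I))‖ ^ 2) := by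
          refine angleMean_mono (Continuous.rpow_const (by fun_prop) fun _ => Or.inr hp.le)
            (by fun_prop) fun θ => ?_
          have h1 := (hW _ (hin θ)).trans (min_le_right _ _)
          obtain ⟨h2, h3⟩ := norm_one_sub_exp_neg_le (hexp _ (hin θ))
          set z := (r : ℂ) * exp ((θ : ℂ) * I)
          have h5 : ‖W.eval z‖ ≤ τ + ‖1 - exp (-F.eval z)‖ := by
            have := norm_le_norm_add_norm_sub' (W.eval z) (1 - exp (-F.eval z))
            linarith
          refine (Real.rpow_le_rpow (norm_nonneg _) h5 hp.le).trans
            ((add_rpow_le_two_rpow_mul hτ0.le (norm_nonneg _) hp.le).trans ?_)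
          have h6 := rpow_le_rpow_add_mul_sq (norm_nonneg _) h2 hτ0 hp.le
          have h7 : ‖1 - exp (-F.eval z)‖ ^ 2 ≤ 4 * ‖F.eval z‖ ^ 2 :=
            (pow_le_pow_left₀ (norm_nonneg _) h3 2).trans_eq (by ring)
          have h8 : 2 ^ p / τ ^ 2 * ‖1 - exp (-F.eval z)‖ ^ 2 ≤
            2 ^ p / τ ^ 2 * (4 * ‖F.eval z‖ ^ 2) := by gcongr
          refine mul_le_mul_of_nonneg_left ?_ (by positivity)
          linarith
      _ ≤ 2 ^ p * (2 * η + 2 ^ p / τ ^ 2 * 4 * (η * τ ^ 2 / (4 * 2 ^ p))) := by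
          rw [angleMean_const_mul, angleMean_add continuous_const (by fun_prop), angleMean_const,
            angleMean_const_mul]
          gcongr
          exact hmean.trans (min_le_right _ _)
      _ ≤ δ := by
          have : 2 ^ p / τ ^ 2 * 4 * (η * τ ^ 2 / (4 * 2 ^ p)) = η := by field_simp
          rw [this, hη]
          have h2 : (2:ℝ) ^ p ≠ 0 := by positivity
          field_simp
          norm_num

/-- Polynomials are uniformly dense in the continuous functions on a compact null subset of the
unit circle. -/
lemma exists_polynomial_near_of_continuousOn_null {K : Set ℂ} (hK : IsCompact K)
    (hKT : K ⊆ sphere (0:ℂ) 1) (hKm : arcMeasure K = 0) {ψ : ℂ → ℂ} (hψ : ContinuousOn ψ K)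
    {δ : ℝ} (hδ : 0 < δ) : ∃ S : Polynomial ℂ, ∀ z ∈ K, ‖S.eval z - ψ z‖ < δ := by
  have : CompactSpace K := isCompact_iff_compactSpace.1 hK
  set A : Subalgebra ℂ C(K, ℂ) := (polynomialFunctions K).topologicalClosure with hA
  have hX : star (toContinuousMapOnAlgHom K (X : Polynomial ℂ)) ∈ A := by
    refine Metric.mem_closure_iff.2 fun η hη => ?_
    obtain ⟨W, hWK, hW0, -⟩ := exists_peak_polynomial hK.isClosed hKT hKm one_pos
      (show 0 < η / 3 by positivity)
    refine ⟨toContinuousMapOnAlgHom K W.divX, ⟨W.divX, by simp, rfl⟩, ?_⟩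
    rw [ContinuousMap.dist_lt_iff hη]
    rintro ⟨z, hz⟩
    have hz1 : ‖z‖ = 1 := by simpa using hKT hz
    have hzz : (starRingEnd ℂ) z * z = 1 := by
      rw [conj_mul', hz1]; simp
    have hdiv : W.eval z = W.divX.eval z * z + W.eval 0 := by
      conv_lhs => rw [← W.divX_mul_X_add]
      simp [coeff_zero_eq_eval_zero]
    have : dist ((starRingEnd ℂ) z) (W.divX.eval z) = ‖(1 - W.eval z) + W.eval 0‖ := by
      rw [dist_eq_norm, ← mul_one ‖_‖, ← hz1, ← norm_mul, sub_mul, hzz, hdiv]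
      congr 1
      ring
    have heq : dist (star (toContinuousMapOnAlgHom K (X : Polynomial ℂ)) ⟨z, hz⟩)
        (toContinuousMapOnAlgHom K W.divX ⟨z, hz⟩) =
        dist ((starRingEnd ℂ) z) (W.divX.eval z) := by simp
    refine (heq.trans this).trans_lt ((norm_add_le _ _).trans_lt ?_)
    have := hWK z hz
    rw [norm_sub_rev] at this
    linarith
  have hle : (polynomialFunctions K).starClosure.toSubalgebra ≤ A := by
    rw [polynomialFunctions.starClosure_eq_adjoin_X, StarAlgebra.adjoin_toSubalgebra]
    refine Algebra.adjoin_le (union_subset ?_ ?_)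
    · rintro _ rfl
      exact Subalgebra.le_topologicalClosure _ ⟨X, by simp, rfl⟩
    · rw [star_singleton]
      rintro _ rfl
      exact hX
  have htop : (⟨_, hψ.domRestrict⟩ : C(K, ℂ)) ∈ closure (polynomialFunctions K : Set C(K, ℂ)) := by
    have h1 : (⟨_, hψ.domRestrict⟩ : C(K, ℂ)) ∈
        (polynomialFunctions K).starClosure.topologicalClosure := by
      rw [polynomialFunctions.starClosure_topologicalClosure]
      trivial
    exact closure_minimal (fun f hf => hle hf) isClosed_closure h1
  obtain ⟨_, ⟨S, -, rfl⟩, hS⟩ := Metric.mem_closure_iff.1 htop δ hδ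
  refine ⟨S, fun z hz => ?_⟩
  have := (ContinuousMap.dist_lt_iff hδ).1 hS ⟨z, hz⟩
  rw [dist_comm, dist_eq_norm] at this
  simpa using this

lemma hardyNorm_le_of_angleMean_le {p : ℝ} (hp : 0 < p) {f : ℂ → ℂ} {c : ℝ} (hc : 0 ≤ c)
    (h : ∀ r ∈ Ioo (0:ℝ) 1, angleMean (fun θ => ‖f ((r : ℂ) * exp ((θ : ℂ) * I))‖ ^ p) ≤ c ^ p) :
    hardyNorm p f ≤ c := by
  have : Nonempty (Ioo (0:ℝ) 1) := ⟨⟨1 / 2, by norm_num⟩⟩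
  refine ciSup_le fun r => ?_
  refine (Real.rpow_le_rpow (angleMean_nonneg fun θ => by positivity) (h r r.2)
    (by positivity)).trans_eq ?_
  rw [one_div, Real.rpow_rpow_inv hc hp.ne']

/-- Lemma (hardymerg): simultaneous approximation in `H^p` norm and uniformly on a compact
null set `K ⊆ 𝕋`. -/
theorem statement_3 (p : ℝ) (hp : 1 ≤ p)
    (K : Set ℂ) (hKc : IsCompact K) (hKT : K ⊆ Metric.sphere (0:ℂ) 1)
    (hKm : arcMeasure K = 0)
    (g : ℂ → ℂ) (hg : MemHp p g) (φ : ℂ → ℂ) (hφ : ContinuousOn φ K)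
    (ε : ℝ) (hε : 0 < ε) :
    ∃ P : Polynomial ℂ,
      hardyNorm p (fun z => P.eval z - g z) < ε ∧ ∀ ζ ∈ K, ‖P.eval ζ - φ ζ‖ < ε := by
  have hp0 : 0 < p := zero_lt_one.trans_le hp
  set η : ℝ := (ε / 2) ^ p / (2 * 2 ^ p) with hη
  have hη0 : 0 < η := by positivity
  obtain ⟨Q, hQ⟩ := hg.exists_polynomial_near hp hη0
  obtain ⟨S, hS⟩ := exists_polynomial_near_of_continuousOn_null hKc hKT hKm
    (ψ := fun z => φ z - Q.eval z) (hφ.sub Q.continuousOn) (half_pos hε)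
  obtain ⟨B, hB⟩ := (isCompact_closedBall (0:ℂ) 1).exists_bound_of_continuousOn
    (f := fun z => S.eval z) S.continuousOn
  have hB0 : 0 ≤ B := (norm_nonneg _).trans (hB 0 (by simp))
  set δ : ℝ := min (ε / (2 * (B + 1))) (η / (B + 1) ^ p) with hδ
  have hδ0 : 0 < δ := by positivity
  obtain ⟨W, hWK, -, hW⟩ := exists_peak_polynomial hKc.isClosed hKT hKm hp0 hδ0
  refine ⟨Q + W * S, ?_, fun z hz => ?_⟩
  · refine (hardyNorm_le_of_angleMean_le hp0 (half_pos hε).le fun r hr => ?_).trans_lt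
      (half_lt_self hε)
    have hgr := continuous_comp_circle hg.1.continuousOn hr
    have hQg : Continuous fun θ : ℝ => ‖Q.eval ((r : ℂ) * exp ((θ : ℂ) * I)) -
        g ((r : ℂ) * exp ((θ : ℂ) * I))‖ ^ p :=
      (Continuous.sub (by fun_prop) hgr).norm.rpow_const fun _ => Or.inr hp0.le
    have hPg : Continuous fun θ : ℝ => ‖(Q + W * S).eval ((r : ℂ) * exp ((θ : ℂ) * I)) -
        g ((r : ℂ) * exp ((θ : ℂ) * I))‖ ^ p :=
      (Continuous.sub (by fun_prop) hgr).norm.rpow_const fun _ => Or.inr hp0.le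
    have hWc : Continuous fun θ : ℝ => (B + 1) ^ p *
        ‖W.eval ((r : ℂ) * exp ((θ : ℂ) * I))‖ ^ p :=
      continuous_const.mul (Continuous.rpow_const (by fun_prop) fun _ => Or.inr hp0.le)
    calc _ ≤ angleMean fun θ => 2 ^ p * (‖Q.eval ((r : ℂ) * exp ((θ : ℂ) * I)) -
          g ((r : ℂ) * exp ((θ : ℂ) * I))‖ ^ p +
          (B + 1) ^ p * ‖W.eval ((r : ℂ) * exp ((θ : ℂ) * I))‖ ^ p) := by
          refine angleMean_mono hPg (continuous_const.mul (hQg.add hWc)) fun θ => ?_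
          have hz := hB ((r : ℂ) * exp ((θ : ℂ) * I))
            (by rw [mem_closedBall_zero_iff, norm_circle hr.1.le]; exact hr.2.le)
          set z := (r : ℂ) * exp ((θ : ℂ) * I)
          have h1 : ‖(Q + W * S).eval z - g z‖ ≤ ‖Q.eval z - g z‖ + (B + 1) * ‖W.eval z‖ := by
            calc _ = ‖(Q.eval z - g z) + S.eval z * W.eval z‖ := by
                  rw [eval_add, eval_mul]; congr 1; ring
              _ ≤ _ := by
                  refine (norm_add_le _ _).trans ?_
                  rw [norm_mul]
                  gcongr
                  linarith
          refine (Real.rpow_le_rpow (norm_nonneg _) h1 hp0.le).trans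
            ((add_rpow_le_two_rpow_mul (norm_nonneg _) (by positivity) hp0.le).trans_eq ?_)
          rw [Real.mul_rpow (by positivity) (norm_nonneg _)]
      _ ≤ 2 ^ p * (η + (B + 1) ^ p * (η / (B + 1) ^ p)) := by
          rw [angleMean_const_mul, angleMean_add hQg hWc, angleMean_const_mul]
          gcongr
          · exact hQ r hr
          · exact (hW r hr).trans (min_le_right _ _)
      _ = (ε / 2) ^ p := by
          have : (B + 1) ^ p ≠ 0 := by positivity
          rw [mul_div_cancel₀ _ this, hη]
          field_simp
          ring
  · have h1 := (hWK z hz).trans (min_le_left _ _)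
    have h2 := hB z (sphere_subset_closedBall (hKT hz))
    calc ‖(Q + W * S).eval z - φ z‖
        = ‖(W.eval z - 1) * S.eval z + (S.eval z - (φ z - Q.eval z))‖ := by
          rw [eval_add, eval_mul]; congr 1; ring
      _ ≤ ε / (2 * (B + 1)) * (B + 1) + ‖S.eval z - (φ z - Q.eval z)‖ := by
          refine (norm_add_le _ _).trans ?_
          rw [norm_mul]
          gcongr
          linarith
      _ < ε / (2 * (B + 1)) * (B + 1) + ε / 2 := by gcongr; exact hS z hz
      _ = ε := by field_simp; ring
end
end

section
/- Let 1 ≤ p < ∞, let ρ ⊆ [0,1) have 1 as a limit point, and let K ⊆ 𝕋 be compact with m(K) = 0. For every j ∈ ℕ and s ∈ ℕ*, the set ⋃_{r∈ρ} U(j,s,r) is dense in H^p(𝔻). -/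
open Complex Metric Set Filter MeasureTheory Polynomial Topology

noncomputable section

/-- A complex polynomial has rational coefficients if the real and imaginary part of each
coefficient is rational. -/
def RatPoly (q : Polynomial ℂ) : Prop :=
  ∀ n : ℕ, ∃ a b : ℚ, q.coeff n = (a : ℂ) + (b : ℂ) * Complex.I

/-- The set `U(j,s,r)` of `f ∈ H^p(𝔻)` with
`sup_{ζ∈K} sup_{|z| ≤ s/(s+1)} |f(r(ζ-z)+z) - P_j(ζ)| < 1/s`. -/
def UHp (p : ℝ) (K : Set ℂ) (P : ℕ → Polynomial ℂ) (j s : ℕ) (r : ℝ) :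
    Set (HpSpace p) :=
  {f : HpSpace p |
    (⨆ ζ ∈ K, ⨆ z ∈ Metric.closedBall (0:ℂ) ((s : ℝ) / ((s : ℝ) + 1)),
      ‖f.1 ((r : ℂ) * (ζ - z) + z) - (P j).eval ζ‖) < 1 / (s : ℝ)}

/-- The `p`-th integral mean of `f` over the circle of radius `r`. -/
def hardyMean (p : ℝ) (f : ℂ → ℂ) (r : ℝ) : ℝ :=
  (Real.circleAverage (fun z ↦ ‖f z‖ ^ p) 0 r) ^ (1 / p)

lemma hardyMean_eq (p : ℝ) (f : ℂ → ℂ) (r : ℝ) :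
    ((1 / (2 * Real.pi)) *
      ∫ θ in (0:ℝ)..(2 * Real.pi),
        ‖f ((r : ℂ) * Complex.exp ((θ : ℂ) * Complex.I))‖ ^ p) ^ (1 / p) = hardyMean p f r := by
  simp [hardyMean, Real.circleAverage_def, circleMap]

lemma hardyNorm_eq_iSup (p : ℝ) (f : ℂ → ℂ) :
    hardyNorm p f = ⨆ r : Set.Ioo (0:ℝ) 1, hardyMean p f r := by
  simp only [hardyNorm, hardyMean_eq]

lemma memHp_iff (p : ℝ) (f : ℂ → ℂ) :
    MemHp p f ↔ DifferentiableOn ℂ f (ball (0:ℂ) 1) ∧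
      BddAbove (Set.range fun r : Set.Ioo (0:ℝ) 1 ↦ hardyMean p f r) := by
  simp only [MemHp, hardyMean_eq]

lemma hardyMean_nonneg (p : ℝ) (f : ℂ → ℂ) (r : ℝ) : 0 ≤ hardyMean p f r :=
  Real.rpow_nonneg (Real.circleAverage_nonneg_of_nonneg fun _ _ ↦ by positivity) _

lemma sphere_subset_unitBall {r : ℝ} (hr : r ∈ Set.Ioo (0:ℝ) 1) :
    sphere (0:ℂ) r ⊆ ball (0:ℂ) 1 := fun z hz ↦ by
  rw [mem_sphere_zero_iff_norm] at hz
  rw [mem_ball_zero_iff, hz]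
  exact hr.2

lemma hardyMean_eq_toReal_eLpNorm {p r : ℝ} (hp : 1 ≤ p) (hr : 0 ≤ r) {f : ℂ → ℂ}
    (hf : ContinuousOn f (sphere 0 r)) :
    MemLp (fun θ ↦ f (circleMap 0 r θ)) (ENNReal.ofReal p)
      (ENNReal.ofReal (2 * Real.pi)⁻¹ • (volume.restrict (Set.Ioc 0 (2 * Real.pi)))) ∧
    hardyMean p f r = (eLpNorm (fun θ ↦ f (circleMap 0 r θ)) (ENNReal.ofReal p)
      (ENNReal.ofReal (2 * Real.pi)⁻¹ •
        (volume.restrict (Set.Ioc 0 (2 * Real.pi))))).toReal := by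
  have hp0 : 0 < p := by linarith
  have hpi := Real.two_pi_pos
  have hc : Continuous fun θ ↦ f (circleMap 0 r θ) :=
    hf.comp_continuous (continuous_circleMap 0 r) fun θ ↦ circleMap_mem_sphere 0 hr θ
  obtain ⟨C, hC⟩ := (isCompact_sphere (0:ℂ) r).exists_bound_of_continuousOn hf
  have hmem : MemLp (fun θ ↦ f (circleMap 0 r θ)) (ENNReal.ofReal p)
      (ENNReal.ofReal (2 * Real.pi)⁻¹ • (volume.restrict (Set.Ioc 0 (2 * Real.pi)))) := by
    refine MemLp.smul_measure ?_ ENNReal.ofReal_ne_top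
    exact MemLp.of_bound hc.aestronglyMeasurable C
      (Eventually.of_forall fun θ ↦ hC _ (circleMap_mem_sphere 0 hr θ))
  refine ⟨hmem, ?_⟩
  rw [hmem.eLpNorm_eq_integral_rpow_norm (by simpa using hp0) ENNReal.ofReal_ne_top,
    ENNReal.toReal_ofReal (by positivity), ENNReal.toReal_ofReal hp0.le, hardyMean,
    integral_smul_measure, ENNReal.toReal_ofReal (by positivity), Real.circleAverage_def,
    intervalIntegral.integral_of_le hpi.le, one_div]

lemma hardyMean_add_le {p r : ℝ} (hp : 1 ≤ p) (hr : 0 ≤ r) {f g : ℂ → ℂ}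
    (hf : ContinuousOn f (sphere 0 r)) (hg : ContinuousOn g (sphere 0 r)) :
    hardyMean p (fun z ↦ f z + g z) r ≤ hardyMean p f r + hardyMean p g r := by
  obtain ⟨hf1, hf2⟩ := hardyMean_eq_toReal_eLpNorm hp hr hf
  obtain ⟨hg1, hg2⟩ := hardyMean_eq_toReal_eLpNorm hp hr hg
  rw [hf2, hg2, (hardyMean_eq_toReal_eLpNorm hp hr (f := fun z ↦ f z + g z) (hf.add hg)).2,
    ← ENNReal.toReal_add hf1.eLpNorm_ne_top hg1.eLpNorm_ne_top]
  refine ENNReal.toReal_mono (ENNReal.add_ne_top.2 ⟨hf1.eLpNorm_ne_top, hg1.eLpNorm_ne_top⟩) ?_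
  exact eLpNorm_add_le hf1.1 hg1.1 (by simpa using hp)

lemma hardyMean_neg (p : ℝ) (f : ℂ → ℂ) (r : ℝ) :
    hardyMean p (fun z ↦ -f z) r = hardyMean p f r := by
  simp [hardyMean]

lemma MemHp.neg {p : ℝ} {f : ℂ → ℂ} (hf : MemHp p f) : MemHp p (fun z ↦ -f z) := by
  rw [memHp_iff] at hf ⊢
  exact ⟨hf.1.neg, by simpa only [hardyMean_neg] using hf.2⟩

lemma MemHp.add {p : ℝ} (hp : 1 ≤ p) {f g : ℂ → ℂ} (hf : MemHp p f) (hg : MemHp p g) :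
    MemHp p (fun z ↦ f z + g z) := by
  rw [memHp_iff] at hf hg ⊢
  refine ⟨hf.1.add hg.1, ?_⟩
  obtain ⟨A, hA⟩ := hf.2
  obtain ⟨B, hB⟩ := hg.2
  refine ⟨A + B, ?_⟩
  rintro _ ⟨r, rfl⟩
  refine (hardyMean_add_le hp r.2.1.le (hf.1.continuousOn.mono (sphere_subset_unitBall r.2))
    (hg.1.continuousOn.mono (sphere_subset_unitBall r.2))).trans ?_
  exact add_le_add (hA ⟨r, rfl⟩) (hB ⟨r, rfl⟩)

lemma MemHp.sub {p : ℝ} (hp : 1 ≤ p) {f g : ℂ → ℂ} (hf : MemHp p f) (hg : MemHp p g) :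
    MemHp p (fun z ↦ f z - g z) := by
  simpa only [sub_eq_add_neg] using hf.add hp hg.neg

lemma hardyNorm_add_le {p : ℝ} (hp : 1 ≤ p) {f g : ℂ → ℂ} (hf : MemHp p f) (hg : MemHp p g) :
    hardyNorm p (fun z ↦ f z + g z) ≤ hardyNorm p f + hardyNorm p g := by
  rw [memHp_iff] at hf hg
  have : Nonempty (Set.Ioo (0:ℝ) 1) := ⟨⟨1 / 2, by norm_num⟩⟩
  simp only [hardyNorm_eq_iSup]
  refine ciSup_le fun r ↦ ?_
  refine (hardyMean_add_le hp r.2.1.le (hf.1.continuousOn.mono (sphere_subset_unitBall r.2))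
    (hg.1.continuousOn.mono (sphere_subset_unitBall r.2))).trans ?_
  exact add_le_add (le_ciSup hf.2 r) (le_ciSup hg.2 r)

lemma exists_hardyBall_subset {p : ℝ} (hp : 1 ≤ p) {O : Set (HpSpace p)} (hO : IsOpen O)
    {g : HpSpace p} (hg : g ∈ O) :
    ∃ ε > 0, ∀ f : HpSpace p, hardyNorm p (fun z ↦ f.1 z - g.1 z) < ε → f ∈ O := by
  induction hO with
  | basic s hs =>
    obtain ⟨h, ε, hε, rfl⟩ := hs
    refine ⟨ε - hardyNorm p (fun z ↦ g.1 z - h.1 z), sub_pos.2 hg, fun f hf ↦ ?_⟩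
    have := hardyNorm_add_le hp (f.2.sub hp g.2) (g.2.sub hp h.2)
    simp only [sub_add_sub_cancel] at this
    rw [Set.mem_ofPred_eq]
    linarith
  | univ => exact ⟨1, one_pos, fun _ _ ↦ trivial⟩
  | inter s t _ _ ihs iht =>
    obtain ⟨a, ha, hs⟩ := ihs hg.1
    obtain ⟨b, hb, ht⟩ := iht hg.2
    exact ⟨min a b, lt_min ha hb, fun f hf ↦
      ⟨hs f (hf.trans_le (min_le_left _ _)), ht f (hf.trans_le (min_le_right _ _))⟩⟩
  | sUnion S _ ih =>
    obtain ⟨s, hs, hgs⟩ := hg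
    obtain ⟨a, ha, h⟩ := ih s hs hgs
    exact ⟨a, ha, fun f hf ↦ ⟨s, hs, h f hf⟩⟩

lemma hardyNorm_le_of_circleAverage_le {p ε : ℝ} (hp : 1 ≤ p) (hε : 0 ≤ ε) {f : ℂ → ℂ}
    (h : ∀ r ∈ Set.Ioo (0:ℝ) 1, Real.circleAverage (fun z ↦ ‖f z‖ ^ p) 0 r ≤ ε ^ p) :
    hardyNorm p f ≤ ε := by
  have : Nonempty (Set.Ioo (0:ℝ) 1) := ⟨⟨1 / 2, by norm_num⟩⟩
  rw [hardyNorm_eq_iSup]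
  refine ciSup_le fun r ↦ ?_
  calc hardyMean p f r ≤ (ε ^ p) ^ (1 / p) := by
        refine Real.rpow_le_rpow ?_ (h r r.2) (by positivity)
        exact Real.circleAverage_nonneg_of_nonneg fun _ _ ↦ by positivity
    _ = ε := by rw [one_div, Real.rpow_rpow_inv hε (by linarith)]

lemma circleIntegrable_of_continuousOn_unitBall {E : Type*} [NormedAddCommGroup E] {f : ℂ → E}
    (hf : ContinuousOn f (ball (0:ℂ) 1)) {r : ℝ} (hr : r ∈ Set.Ioo (0:ℝ) 1) :
    CircleIntegrable f 0 r :=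
  (hf.mono (sphere_subset_unitBall hr)).circleIntegrable hr.1.le

lemma memHp_of_bounded {p C : ℝ} (hp : 1 ≤ p) {f : ℂ → ℂ}
    (hf : DifferentiableOn ℂ f (ball (0:ℂ) 1)) (hC : ∀ z ∈ ball (0:ℂ) 1, ‖f z‖ ≤ C) :
    MemHp p f := by
  rw [memHp_iff]
  refine ⟨hf, (C ^ p) ^ (1 / p), ?_⟩
  rintro _ ⟨r, rfl⟩
  refine Real.rpow_le_rpow (Real.circleAverage_nonneg_of_nonneg fun _ _ ↦ by positivity) ?_
    (by positivity)
  refine Real.circleAverage_mono_on_of_le_circle (circleIntegrable_of_continuousOn_unitBall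
    (hf.continuousOn.norm.rpow_const fun _ _ ↦ Or.inr (by linarith)) r.2) fun z hz ↦ ?_
  rw [abs_of_pos r.2.1] at hz
  gcongr
  exact hC z (sphere_subset_unitBall r.2 hz)

lemma norm_inv_one_add_le {F : ℂ} (hF : 0 ≤ F.re) : ‖(1 + F)⁻¹‖ ≤ 1 := by
  rw [norm_inv]
  refine inv_le_one_of_one_le₀ ?_
  have := Complex.re_le_norm (1 + F)
  simp at this
  linarith

lemma one_add_ne_zero_of_re_nonneg {F : ℂ} (hF : 0 ≤ F.re) : 1 + F ≠ 0 := fun h ↦ by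
  have := congrArg Complex.re h
  simp at this
  linarith

lemma one_sub_inv_one_add {F : ℂ} (hF : 0 ≤ F.re) : 1 - (1 + F)⁻¹ = F * (1 + F)⁻¹ := by
  have := one_add_ne_zero_of_re_nonneg hF
  field_simp
  ring

lemma norm_one_sub_inv_one_add_le_norm {F : ℂ} (hF : 0 ≤ F.re) : ‖1 - (1 + F)⁻¹‖ ≤ ‖F‖ := by
  rw [one_sub_inv_one_add hF, norm_mul]
  exact mul_le_of_le_one_right (norm_nonneg _) (norm_inv_one_add_le hF)

lemma norm_one_sub_inv_one_add_le_one {F : ℂ} (hF : 0 ≤ F.re) : ‖1 - (1 + F)⁻¹‖ ≤ 1 := by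
  rw [one_sub_inv_one_add hF, norm_mul, norm_inv, ← div_eq_mul_inv]
  refine div_le_one_of_le₀ ?_ (norm_nonneg _)
  rw [← sq_le_sq₀ (norm_nonneg _) (norm_nonneg _), ← Complex.normSq_eq_norm_sq,
    ← Complex.normSq_eq_norm_sq, Complex.normSq_apply, Complex.normSq_apply]
  simp
  nlinarith

lemma norm_one_sub_sq_le {w : ℂ} (hw : ‖w‖ ≤ 1) : ‖1 - w‖ ^ 2 ≤ 2 * (1 - w).re := by
  have h : ‖w‖ ^ 2 ≤ 1 := pow_le_one₀ (norm_nonneg _) hw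
  rw [← Complex.normSq_eq_norm_sq, Complex.normSq_apply] at h ⊢
  simp
  nlinarith

/-- If `F` has nonnegative real part and `F 0` is small, then `1 - (1 + F)⁻¹` is small in mean. -/
lemma circleAverage_norm_one_sub_inv_one_add_le {F : ℂ → ℂ}
    (hF : DifferentiableOn ℂ F (ball (0:ℂ) 1)) (hre : ∀ z ∈ ball (0:ℂ) 1, 0 ≤ (F z).re)
    {η : ℝ} (hη : 0 < η) {r : ℝ} (hr : r ∈ Set.Ioo (0:ℝ) 1) :
    Real.circleAverage (fun z ↦ ‖1 - (1 + F z)⁻¹‖) 0 r ≤ η + 2 * ‖F 0‖ / η := by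
  have hw : DifferentiableOn ℂ (fun z ↦ 1 - (1 + F z)⁻¹) (ball (0:ℂ) 1) :=
    ((hF.const_add 1).fun_inv fun z hz ↦ one_add_ne_zero_of_re_nonneg (hre z hz)).const_sub 1
  have hint := circleIntegrable_of_continuousOn_unitBall hw.continuousOn hr
  have hre_int : CircleIntegrable (fun z ↦ (1 - (1 + F z)⁻¹).re) 0 r :=
    circleIntegrable_of_continuousOn_unitBall
      (Complex.continuous_re.comp_continuousOn hw.continuousOn) hr
  have hav : Real.circleAverage (fun z ↦ (1 - (1 + F z)⁻¹).re) 0 r ≤ ‖F 0‖ := by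
    have h1 := Complex.reCLM.circleAverage_comp_comm hint
    have h2 : Real.circleAverage (fun z ↦ 1 - (1 + F z)⁻¹) 0 r = 1 - (1 + F 0)⁻¹ := by
      refine DiffContOnCl.circleAverage (DifferentiableOn.diffContOnCl ?_)
      rw [abs_of_pos hr.1, closure_ball _ hr.1.ne']
      exact hw.mono (closedBall_subset_ball hr.2)
    rw [h2] at h1
    calc _ = (1 - (1 + F 0)⁻¹).re := h1
      _ ≤ ‖1 - (1 + F 0)⁻¹‖ := Complex.re_le_norm _
      _ ≤ ‖F 0‖ := norm_one_sub_inv_one_add_le_norm (hre 0 (by simp))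
  calc Real.circleAverage (fun z ↦ ‖1 - (1 + F z)⁻¹‖) 0 r
      ≤ Real.circleAverage (fun z ↦ η + (2 / η) • (1 - (1 + F z)⁻¹).re) 0 r := by
        refine Real.circleAverage_mono
          (circleIntegrable_of_continuousOn_unitBall hw.continuousOn.norm hr)
          ((circleIntegrable_const η _ _).add hre_int.const_smul) fun z hz ↦ ?_
        rw [abs_of_pos hr.1] at hz
        have h := norm_one_sub_sq_le
          (norm_inv_one_add_le (hre z (sphere_subset_unitBall hr hz)))
        set x := ‖1 - (1 + F z)⁻¹‖
        have hx : x ≤ η + x ^ 2 / η := by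
          rw [← sub_le_iff_le_add', le_div_iff₀ hη]
          nlinarith [sq_nonneg (x - η), sq_nonneg x]
        refine hx.trans ?_
        rw [smul_eq_mul, div_mul_eq_mul_div]
        gcongr
    _ = η + (2 / η) * Real.circleAverage (fun z ↦ (1 - (1 + F z)⁻¹).re) 0 r := by
        rw [Real.circleAverage_fun_add (f₂ := fun z ↦ (2 / η) • (1 - (1 + F z)⁻¹).re)
          (circleIntegrable_const η _ _) hre_int.const_smul, Real.circleAverage_const,
          Real.circleAverage_fun_smul, smul_eq_mul]
    _ ≤ η + 2 * ‖F 0‖ / η := by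
        rw [mul_div_right_comm]
        gcongr

/-- A local minorant of `‖G‖ ^ q` by the real part of a holomorphic function, touching at `z₀`. -/
lemma exists_local_re_le_norm_rpow {q : ℝ} (hq : 0 < q) {G : ℂ → ℂ} {z₀ : ℂ}
    (hG : ∀ᶠ z in 𝓝 z₀, DifferentiableAt ℂ G z) :
    ∃ L : ℂ → ℂ, (∀ᶠ z in 𝓝 z₀, DifferentiableAt ℂ L z) ∧
      (∀ᶠ z in 𝓝 z₀, (L z).re ≤ ‖G z‖ ^ q) ∧ (L z₀).re = ‖G z₀‖ ^ q := by
  by_cases h0 : G z₀ = 0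
  · refine ⟨fun _ ↦ 0, Eventually.of_forall fun z ↦ by fun_prop,
      Eventually.of_forall fun z ↦ by simpa using by positivity, ?_⟩
    simp [h0, Real.zero_rpow hq.ne']
  · have hcont : ContinuousAt (fun z ↦ G z / G z₀) z₀ :=
      hG.self_of_nhds.continuousAt.div_const _
    have hslit : ∀ᶠ z in 𝓝 z₀, G z / G z₀ ∈ Complex.slitPlane :=
      hcont.eventually_mem (Complex.isOpen_slitPlane.mem_nhds (by simp [h0]))
    refine ⟨fun z ↦ ((‖G z₀‖ ^ q : ℝ) : ℂ) * Complex.exp (q * Complex.log (G z / G z₀)),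
      ?_, ?_, ?_⟩
    · filter_upwards [hG, hslit] with z hz hs
      exact (((hz.div_const _).clog hs).const_mul _).cexp.const_mul _
    · filter_upwards [hslit] with z hs
      have hne : G z / G z₀ ≠ 0 := Complex.slitPlane_ne_zero hs
      have hpos : 0 < ‖G z₀‖ := norm_pos_iff.2 h0
      refine (Complex.re_le_norm _).trans (le_of_eq ?_)
      rw [norm_mul, Complex.norm_exp, Complex.norm_real, Real.norm_of_nonneg (by positivity),
        Complex.re_ofReal_mul, Complex.log_re, mul_comm q, ← Real.rpow_def_of_pos
        (norm_pos_iff.2 hne), ← Real.mul_rpow hpos.le (norm_nonneg _), norm_div,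
        mul_div_cancel₀ _ hpos.ne']
    · simp [h0]

/-- Maximum principle for `‖G‖ ^ q - re H`. -/
lemma norm_rpow_le_re_of_sphere {q : ℝ} (hq : 0 < q) {G H : ℂ → ℂ}
    (hGc : ContinuousOn G (closedBall 0 1)) (hHc : ContinuousOn H (closedBall 0 1))
    (hG : DifferentiableOn ℂ G (ball 0 1)) (hH : DifferentiableOn ℂ H (ball 0 1))
    (hle : ∀ z ∈ sphere (0:ℂ) 1, ‖G z‖ ^ q ≤ (H z).re) :
    ∀ z ∈ closedBall (0:ℂ) 1, ‖G z‖ ^ q ≤ (H z).re := by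
  set v : ℂ → ℝ := fun z ↦ ‖G z‖ ^ q - (H z).re with hv
  have hvc : ContinuousOn v (closedBall 0 1) :=
    (hGc.norm.rpow_const fun _ _ ↦ Or.inr hq.le).sub
      (Complex.continuous_re.comp_continuousOn hHc)
  obtain ⟨z₁, hz₁, hmax⟩ := (isCompact_closedBall (0:ℂ) 1).exists_isMaxOn (by simp) hvc
  by_cases hm : v z₁ ≤ 0
  · exact fun z hz ↦ sub_nonpos.1 ((hmax hz).trans hm)
  exfalso
  push Not at hm
  have hS : IsCompact (closedBall (0:ℂ) 1 ∩ v ⁻¹' {v z₁}) :=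
    (isCompact_closedBall (0:ℂ) 1).of_isClosed_subset
      (hvc.preimage_isClosed_of_isClosed isClosed_closedBall isClosed_singleton)
      Set.inter_subset_left
  obtain ⟨z₀, hz₀, hz₀max⟩ := hS.exists_isMaxOn ⟨z₁, hz₁, rfl⟩ Complex.continuous_re.continuousOn
  have hv₀ : v z₀ = v z₁ := hz₀.2
  have hz₀b : z₀ ∈ ball (0:ℂ) 1 := by
    by_contra hcon
    have : z₀ ∈ sphere (0:ℂ) 1 := by
      have h := hz₀.1
      simp only [mem_closedBall, mem_ball, mem_sphere] at h hcon ⊢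
      linarith
    have := hle z₀ this
    rw [← hv₀] at hm
    simp only [hv] at hm
    linarith
  have hnhds : ball (0:ℂ) 1 ∈ 𝓝 z₀ := isOpen_ball.mem_nhds hz₀b
  have hGd : ∀ᶠ z in 𝓝 z₀, DifferentiableAt ℂ G z := hG.eventually_differentiableAt hnhds
  have hHd : ∀ᶠ z in 𝓝 z₀, DifferentiableAt ℂ H z := hH.eventually_differentiableAt hnhds
  obtain ⟨L, hLd, hLle, hL₀⟩ := exists_local_re_le_norm_rpow hq hGd
  have hev : ∀ᶠ z in 𝓝 z₀, Complex.exp (L z - H z) = Complex.exp (L z₀ - H z₀) := by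
    refine Complex.eventually_eq_of_isLocalMax_norm (f := fun z ↦ Complex.exp (L z - H z)) ?_ ?_
    · filter_upwards [hLd, hHd] with z h1 h2 using (h1.sub h2).cexp
    · filter_upwards [hLle, hnhds] with z h1 h2
      have h3 : v z ≤ v z₁ := hmax (ball_subset_closedBall h2)
      rw [← hv₀] at h3
      simp only [hv] at h3
      simp only [Function.comp_apply, Complex.norm_exp, Complex.sub_re, hL₀]
      exact Real.exp_le_exp.2 (by linarith)
  have hv_ev : ∀ᶠ z in 𝓝 z₀, z ∈ closedBall (0:ℂ) 1 ∩ v ⁻¹' {v z₁} := by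
    filter_upwards [hev, hLle, hnhds] with z h1 h2 h3
    refine ⟨ball_subset_closedBall h3, le_antisymm (hmax (ball_subset_closedBall h3)) ?_⟩
    have h4 := congrArg norm h1
    simp only [Complex.norm_exp, Real.exp_eq_exp, Complex.sub_re, hL₀] at h4
    rw [← hv₀]
    simp only [hv]
    linarith
  obtain ⟨δ, hδ, hball⟩ := Metric.eventually_nhds_iff_ball.1 hv_ev
  have := hz₀max (hball (z₀ + (δ / 2 : ℝ)) (by
    rw [mem_ball, dist_eq_norm, add_sub_cancel_left, Complex.norm_real,
      Real.norm_of_nonneg (by positivity)]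
    linarith))
  simp at this
  linarith

lemma exists_polynomial_of_mem_span_fourier {h : C(AddCircle (2 * Real.pi), ℂ)}
    (hh : h ∈ Submodule.span ℂ (Set.range (@fourier (2 * Real.pi)))) :
    ∃ A B : Polynomial ℂ, ∀ x, h x = A.eval (AddCircle.toCircle x : ℂ) +
      (starRingEnd ℂ) (B.eval (AddCircle.toCircle x : ℂ)) := by
  induction hh using Submodule.span_induction with
  | mem f hf =>
    obtain ⟨n, rfl⟩ := hf
    obtain ⟨k, rfl | rfl⟩ := n.eq_nat_or_neg
    · refine ⟨X ^ k, 0, fun x ↦ ?_⟩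
      simp [fourier_apply, AddCircle.toCircle_nsmul]
    · refine ⟨0, X ^ k, fun x ↦ ?_⟩
      rw [fourier_neg]
      simp [fourier_apply, AddCircle.toCircle_nsmul]
  | zero => exact ⟨0, 0, fun x ↦ by simp⟩
  | add f g _ _ hf hg =>
    obtain ⟨A, B, h1⟩ := hf
    obtain ⟨A', B', h2⟩ := hg
    refine ⟨A + A', B + B', fun x ↦ ?_⟩
    simp [h1, h2]
    ring
  | smul c f _ hf =>
    obtain ⟨A, B, h1⟩ := hf
    refine ⟨C c * A, C ((starRingEnd ℂ) c) * B, fun x ↦ ?_⟩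
    simp [h1]
    ring

/-- Every continuous real function on the unit circle is the real part of a polynomial, up to a
one-sided error. -/
lemma exists_polynomial_re_approx {u : ℂ → ℝ} (hu : ContinuousOn u (sphere (0:ℂ) 1)) {ε : ℝ}
    (hε : 0 < ε) :
    ∃ Q : Polynomial ℂ, (Q.eval 0).im = 0 ∧
      ∀ z ∈ sphere (0:ℂ) 1, u z ≤ (Q.eval z).re ∧ (Q.eval z).re ≤ u z + ε := by
  have : Fact (0 < 2 * Real.pi) := ⟨Real.two_pi_pos⟩
  have hc : Continuous fun x : AddCircle (2 * Real.pi) ↦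
      (((u (AddCircle.toCircle x : ℂ) + ε / 2 : ℝ)) : ℂ) := by
    refine Complex.continuous_ofReal.comp (Continuous.add ?_ continuous_const)
    exact hu.comp_continuous (continuous_subtype_val.comp AddCircle.continuous_toCircle)
      fun x ↦ mem_sphere_zero_iff_norm.2 (Circle.norm_coe _)
  set f : C(AddCircle (2 * Real.pi), ℂ) := ⟨_, hc⟩ with hf
  have hmem : f ∈ (Submodule.span ℂ (Set.range (@fourier (2 * Real.pi)))).topologicalClosure := by
    rw [span_fourier_closure_eq_top]
    trivial
  rw [← SetLike.mem_coe, Submodule.topologicalClosure_coe, Metric.mem_closure_iff] at hmem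
  obtain ⟨h, hh, hdist⟩ := hmem (ε / 2) (by positivity)
  obtain ⟨A, B, hAB⟩ := exists_polynomial_of_mem_span_fourier hh
  refine ⟨A + B - C ((((A + B).eval 0).im : ℂ) * Complex.I), by simp, fun z hz ↦ ?_⟩
  set x : AddCircle (2 * Real.pi) := ((Complex.arg z : ℝ) : AddCircle (2 * Real.pi))
  have hx : (AddCircle.toCircle x : ℂ) = z := by
    have h1 := Complex.norm_mul_exp_arg_mul_I z
    rw [mem_sphere_zero_iff_norm.1 hz] at h1
    rw [AddCircle.toCircle_apply_mk, div_self Real.two_pi_pos.ne', one_mul, Circle.coe_exp]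
    simpa using h1
  have h1 : ‖f x - h x‖ < ε / 2 := by
    rw [← ContinuousMap.sub_apply]
    exact ((f - h).norm_coe_le_norm x).trans_lt (by rwa [← dist_eq_norm])
  have h2 := (Complex.abs_re_le_norm _).trans_lt h1
  rw [hAB, hx] at h2
  simp only [hf, ContinuousMap.coe_mk, hx, Complex.sub_re, Complex.add_re, Complex.conj_re,
    Complex.ofReal_re] at h2
  rw [abs_lt] at h2
  simp
  constructor <;> linarith

lemma circleAverage_sq_norm_le {Q : Polynomial ℂ} (h0 : (Q.eval 0).im = 0) :
    Real.circleAverage (fun z ↦ ‖Q.eval z‖ ^ 2) 0 1 ≤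
      2 * Real.circleAverage (fun z ↦ (Q.eval z).re ^ 2) 0 1 := by
  have hc : Continuous fun z ↦ Q.eval z := Q.continuous
  have hint : ∀ {E : Type} [NormedAddCommGroup E] {f : ℂ → E}, Continuous f →
      CircleIntegrable f 0 1 := fun hf ↦ hf.continuousOn.circleIntegrable zero_le_one
  have h1 : Real.circleAverage (fun z ↦ (Q.eval z) ^ 2) 0 1 = (Q.eval 0) ^ 2 :=
    DiffContOnCl.circleAverage (Differentiable.diffContOnCl (by fun_prop))
  have h2 := Complex.reCLM.circleAverage_comp_comm (f := fun z ↦ (Q.eval z) ^ 2) (c := 0) (R := 1)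
    (hint (by fun_prop))
  have h3 : 0 ≤ Real.circleAverage (fun z ↦ ((Q.eval z) ^ 2).re) 0 1 := by
    change Real.circleAverage (fun z ↦ ((Q.eval z) ^ 2).re) 0 1 = _ at h2
    rw [h2, h1]
    simp [sq, h0, mul_self_nonneg]
  have h4 : Real.circleAverage (fun z ↦ ‖Q.eval z‖ ^ 2 + ((Q.eval z) ^ 2).re) 0 1 =
      Real.circleAverage (fun z ↦ (2 : ℝ) • (Q.eval z).re ^ 2) 0 1 := by
    congr 1
    ext z
    rw [← Complex.normSq_eq_norm_sq, Complex.normSq_apply]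
    simp [sq]
    ring
  rw [Real.circleAverage_fun_add (hint (by fun_prop)) (hint (by fun_prop)),
    Real.circleAverage_fun_smul, smul_eq_mul] at h4
  linarith

lemma sum_sq_norm_coeff_le {Q : Polynomial ℂ} (h0 : (Q.eval 0).im = 0) (s : Finset ℕ) :
    ∑ i ∈ s, ‖Q.coeff i‖ ^ 2 ≤ 2 * Real.circleAverage (fun z ↦ (Q.eval z).re ^ 2) 0 1 := by
  refine le_trans ?_ (circleAverage_sq_norm_le h0)
  rw [← Polynomial.sum_sq_norm_coeff_eq_circleAverage]
  rw [← Finset.sum_filter_ne_zero]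
  refine Finset.sum_le_sum_of_subset_of_nonneg (fun i hi ↦ ?_) fun _ _ _ ↦ by positivity
  simpa using (Finset.mem_filter.1 hi).2

/-- Polynomial majorants of `‖g‖ ^ (p / 2)` on smaller disks with uniformly `ℓ²`-bounded
coefficients. -/
lemma MemHp.exists_polynomial_majorant {p : ℝ} (hp : 1 ≤ p) {g : ℂ → ℂ} (hg : MemHp p g) :
    ∃ M : ℝ, ∀ R ∈ Set.Ioo (0:ℝ) 1, ∃ Q : Polynomial ℂ,
      (∀ z ∈ closedBall (0:ℂ) 1, ‖g (R * z)‖ ^ (p / 2) ≤ (Q.eval z).re) ∧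
      ∀ s : Finset ℕ, ∑ i ∈ s, ‖Q.coeff i‖ ^ 2 ≤ M := by
  obtain ⟨hgd, A, hA⟩ := (memHp_iff p g).1 hg
  refine ⟨2 * (2 * A ^ p + 2), fun R hR ↦ ?_⟩
  have hmaps : ∀ z ∈ closedBall (0:ℂ) 1, (R : ℂ) * z ∈ ball (0:ℂ) 1 := fun z hz ↦ by
    rw [mem_closedBall_zero_iff] at hz
    rw [mem_ball_zero_iff, norm_mul, Complex.norm_real, Real.norm_of_nonneg hR.1.le]
    nlinarith [hR.1, hR.2, norm_nonneg z]
  have hcont : ContinuousOn (fun z ↦ g (R * z)) (closedBall 0 1) :=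
    hgd.continuousOn.comp (by fun_prop) hmaps
  have hdiff : DifferentiableOn ℂ (fun z ↦ g (R * z)) (ball 0 1) :=
    hgd.comp (by fun_prop) fun z hz ↦ hmaps z (ball_subset_closedBall hz)
  have hu : ContinuousOn (fun z ↦ ‖g (R * z)‖ ^ (p / 2)) (sphere 0 1) :=
    (hcont.mono sphere_subset_closedBall).norm.rpow_const fun _ _ ↦ Or.inr (by linarith)
  obtain ⟨Q, hQ0, hQ⟩ := exists_polynomial_re_approx hu one_pos
  refine ⟨Q, norm_rpow_le_re_of_sphere (by linarith) hcont (by fun_prop) hdiff (by fun_prop)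
    fun z hz ↦ (hQ z hz).1, fun s ↦ (sum_sq_norm_coeff_le hQ0 s).trans ?_⟩
  have hint : CircleIntegrable (fun z ↦ ‖g (R * z)‖ ^ p) 0 1 :=
    ((hcont.mono sphere_subset_closedBall).norm.rpow_const
      fun _ _ ↦ Or.inr (by linarith)).circleIntegrable zero_le_one
  have hav : Real.circleAverage (fun z ↦ ‖g (R * z)‖ ^ p) 0 1 ≤ A ^ p := by
    have h1 := Real.circleAverage_eq_circleAverage_zero_one (f := fun z ↦ ‖g z‖ ^ p) (c := 0)
      (R := R)
    simp only [add_zero] at h1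
    rw [← h1]
    have h2 : 0 ≤ Real.circleAverage (fun z ↦ ‖g z‖ ^ p) 0 R :=
      Real.circleAverage_nonneg_of_nonneg fun _ _ ↦ by positivity
    calc _ = (hardyMean p g R) ^ p := by
          rw [hardyMean, one_div, Real.rpow_inv_rpow h2 (by linarith)]
      _ ≤ A ^ p := by
          have := hA ⟨⟨R, hR⟩, rfl⟩
          exact Real.rpow_le_rpow (hardyMean_nonneg _ _ _) this (by linarith)
  gcongr
  calc Real.circleAverage (fun z ↦ (Q.eval z).re ^ 2) 0 1
      ≤ Real.circleAverage (fun z ↦ (2 : ℝ) • ‖g (R * z)‖ ^ p + 2) 0 1 := by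
        refine Real.circleAverage_mono (Continuous.continuousOn
          (by have := Q.continuous; fun_prop)|>.circleIntegrable zero_le_one)
          (hint.const_smul.add (circleIntegrable_const 2 _ _)) fun z hz ↦ ?_
        rw [abs_one] at hz
        obtain ⟨h1, h2⟩ := hQ z hz
        have h3 : ‖g (R * z)‖ ^ p = (‖g (R * z)‖ ^ (p / 2)) ^ 2 := by
          rw [← Real.rpow_natCast, ← Real.rpow_mul (norm_nonneg _)]
          congr 1
          push_cast
          ring
        have h4 : 0 ≤ ‖g (R * z)‖ ^ (p / 2) := by positivity
        rw [h3, smul_eq_mul]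
        nlinarith [sq_nonneg (‖g (R * z)‖ ^ (p / 2) - 1)]
    _ = 2 * Real.circleAverage (fun z ↦ ‖g (R * z)‖ ^ p) 0 1 + 2 := by
        rw [Real.circleAverage_fun_add (f₁ := fun z ↦ (2 : ℝ) • ‖g (R * z)‖ ^ p) hint.const_smul
          (circleIntegrable_const 2 _ _), Real.circleAverage_const, Real.circleAverage_fun_smul,
          smul_eq_mul]
    _ ≤ 2 * A ^ p + 2 := by gcongr

lemma norm_mul_pow_le {a z : ℂ} {B t : ℝ} (ha : ‖a‖ ≤ B) (hz : ‖z‖ ≤ t) (k : ℕ) :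
    ‖a * z ^ k‖ ≤ B * t ^ k := by
  rw [norm_mul, norm_pow]
  have : 0 ≤ B := (norm_nonneg a).trans ha
  gcongr

lemma circleAverage_sq_norm_sum_le {a : ℕ → ℂ} {t : ℝ} (ht : t ∈ Set.Ioo (0:ℝ) 1)
    (s : Finset ℕ) :
    Real.circleAverage (fun z ↦ ‖∑ k ∈ s, a k * z ^ k‖ ^ 2) 0 t ≤ ∑ k ∈ s, ‖a k‖ ^ 2 := by
  set P : Polynomial ℂ := ∑ k ∈ s, monomial k (a k * t ^ k) with hP
  have hcoeff : ∀ i, P.coeff i = if i ∈ s then a i * t ^ i else 0 := fun i ↦ by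
    simp [hP, Polynomial.finsetSum_coeff, Polynomial.coeff_monomial]
  rw [Real.circleAverage_eq_circleAverage_zero_one]
  have h1 : Real.circleAverage (fun z ↦ ‖∑ k ∈ s, a k * ((t : ℂ) * z + 0) ^ k‖ ^ 2) 0 1 =
      Real.circleAverage (fun z ↦ ‖P.eval z‖ ^ 2) 0 1 := by
    congr 1
    ext z
    simp [hP, Polynomial.eval_finsetSum, mul_pow, mul_assoc]
  rw [h1, ← Polynomial.sum_sq_norm_coeff_eq_circleAverage]
  have hsub : P.support ⊆ s := fun i hi ↦ by
    rw [Polynomial.mem_support_iff, hcoeff] at hi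
    by_contra h
    simp [h] at hi
  refine (Finset.sum_le_sum_of_subset_of_nonneg hsub fun _ _ _ ↦ by positivity).trans ?_
  refine Finset.sum_le_sum fun i hi ↦ ?_
  rw [hcoeff, if_pos hi]
  gcongr
  refine (norm_mul_pow_le le_rfl (t := 1) ?_ i).trans (by simp)
  rw [Complex.norm_real, Real.norm_of_nonneg ht.1.le]
  exact ht.2.le

/-- A power series with bounded coefficients converges uniformly on smaller disks. -/
lemma tendstoUniformlyOn_powerSeries {a : ℕ → ℂ} {B : ℝ} (ha : ∀ k, ‖a k‖ ≤ B) {t : ℝ}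
    (ht : t ∈ Set.Ioo (0:ℝ) 1) :
    TendstoUniformlyOn (fun N z ↦ ∑ k ∈ Finset.range N, a k * z ^ k)
      (fun z ↦ ∑' k, a k * z ^ k) atTop (closedBall (0:ℂ) t) :=
  tendstoUniformlyOn_tsum_nat (u := fun k ↦ B * t ^ k)
    ((summable_geometric_of_lt_one ht.1.le ht.2).mul_left B)
    fun k z hz ↦ norm_mul_pow_le (ha k) (by simpa using hz) k

lemma differentiableOn_powerSeries {a : ℕ → ℂ} {B : ℝ} (ha : ∀ k, ‖a k‖ ≤ B) :
    DifferentiableOn ℂ (fun z ↦ ∑' k, a k * z ^ k) (ball (0:ℂ) 1) := fun z hz ↦ by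
  rw [mem_ball_zero_iff] at hz
  obtain ⟨t, ht1, ht2⟩ := exists_between hz
  have ht0 : 0 ≤ t := (norm_nonneg z).trans ht1.le
  have := differentiableOn_tsum_of_summable_norm (F := fun k z ↦ a k * z ^ k)
    (U := ball (0:ℂ) t) ((summable_geometric_of_lt_one ht0 ht2).mul_left B)
    (fun k ↦ by fun_prop) isOpen_ball
    fun k w hw ↦ norm_mul_pow_le (ha k) (mem_ball_zero_iff.1 hw).le k
  exact (this.differentiableAt (isOpen_ball.mem_nhds
    (mem_ball_zero_iff.2 ht1))).differentiableWithinAt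

/-- Square-summable power series are approximated in quadratic mean by their partial sums,
uniformly over all circles. -/
lemma exists_circleAverage_sq_norm_sub_le {a : ℕ → ℂ} {M : ℝ}
    (ha : ∀ s : Finset ℕ, ∑ k ∈ s, ‖a k‖ ^ 2 ≤ M) {ε : ℝ} (hε : 0 < ε) :
    ∃ N : ℕ, ∀ t ∈ Set.Ioo (0:ℝ) 1, Real.circleAverage
      (fun z ↦ ‖(∑' k, a k * z ^ k) - ∑ k ∈ Finset.range N, a k * z ^ k‖ ^ 2) 0 t ≤ ε := by
  have hB : ∀ k, ‖a k‖ ≤ Real.sqrt M := fun k ↦ Real.le_sqrt_of_sq_le (by simpa using ha {k})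
  have hsum : Summable fun k ↦ ‖a k‖ ^ 2 :=
    summable_of_sum_le (fun _ ↦ by positivity) ha
  obtain ⟨s, hs⟩ := hsum.vanishing (Metric.ball_mem_nhds (0:ℝ) (ε := ε / 4) (by positivity))
  obtain ⟨N, hN⟩ := s.exists_nat_subset_range
  refine ⟨N, fun t ht ↦ ?_⟩
  obtain ⟨m, hm, hNm⟩ := (((Metric.tendstoUniformlyOn_iff.1 (tendstoUniformlyOn_powerSeries hB ht)
    (Real.sqrt (ε / 4)) (by positivity)).and (eventually_ge_atTop N)).exists)
  have hdc := (differentiableOn_powerSeries hB).continuousOn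
  have hint : CircleIntegrable (fun z ↦ ‖∑ k ∈ Finset.Ico N m, a k * z ^ k‖ ^ 2) 0 t :=
    (Continuous.continuousOn (by fun_prop)).circleIntegrable ht.1.le
  calc _ ≤ Real.circleAverage
        (fun z ↦ (2 : ℝ) • ‖∑ k ∈ Finset.Ico N m, a k * z ^ k‖ ^ 2 + ε / 2) 0 t := by
        refine Real.circleAverage_mono (circleIntegrable_of_continuousOn_unitBall
          ((hdc.sub (by fun_prop)).norm.pow 2) ht)
          (hint.const_smul.add (circleIntegrable_const _ _ _)) fun z hz ↦ ?_
        rw [abs_of_pos ht.1] at hz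
        have h1 := hm z (sphere_subset_closedBall hz)
        rw [dist_eq_norm] at h1
        have h2 : ‖(∑' k, a k * z ^ k) - ∑ k ∈ Finset.range m, a k * z ^ k‖ ^ 2 ≤ ε / 4 := by
          rw [← Real.sq_sqrt (show 0 ≤ ε / 4 by positivity)]
          gcongr
        have h3 : (∑' k, a k * z ^ k) - ∑ k ∈ Finset.range N, a k * z ^ k =
            ((∑' k, a k * z ^ k) - ∑ k ∈ Finset.range m, a k * z ^ k) +
              ∑ k ∈ Finset.Ico N m, a k * z ^ k := by
          rw [Finset.sum_Ico_eq_sub _ hNm]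
          ring
        rw [h3, smul_eq_mul]
        have h4 := norm_add_le ((∑' k, a k * z ^ k) - ∑ k ∈ Finset.range m, a k * z ^ k)
          (∑ k ∈ Finset.Ico N m, a k * z ^ k)
        set x := ‖(∑' k, a k * z ^ k) - ∑ k ∈ Finset.range m, a k * z ^ k‖
        set y := ‖∑ k ∈ Finset.Ico N m, a k * z ^ k‖
        calc _ ≤ (x + y) ^ 2 := by gcongr
          _ ≤ _ := by nlinarith [sq_nonneg (x - y)]
    _ = 2 * Real.circleAverage (fun z ↦ ‖∑ k ∈ Finset.Ico N m, a k * z ^ k‖ ^ 2) 0 t + ε / 2 := by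
        rw [Real.circleAverage_fun_add
          (f₁ := fun z ↦ (2 : ℝ) • ‖∑ k ∈ Finset.Ico N m, a k * z ^ k‖ ^ 2) hint.const_smul
          (circleIntegrable_const _ _ _), Real.circleAverage_const, Real.circleAverage_fun_smul,
          smul_eq_mul]
    _ ≤ 2 * (ε / 4) + ε / 2 := by
        gcongr
        refine (circleAverage_sq_norm_sum_le ht _).trans ?_
        have h5 := hs (Finset.Ico N m) (Finset.disjoint_left.2 fun i hi his ↦ by
          have := Finset.mem_range.1 (hN his)
          have := (Finset.mem_Ico.1 hi).1
          omega)
        rw [mem_ball_zero_iff] at h5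
        exact (Real.le_norm_self _).trans h5.le
    _ = ε := by ring

/-- A holomorphic majorant with square-summable coefficients for a function in `H^p`. -/
lemma MemHp.exists_powerSeries_majorant {p : ℝ} (hp : 1 ≤ p) {g : ℂ → ℂ} (hg : MemHp p g) :
    ∃ (a : ℕ → ℂ) (M : ℝ), (∀ s : Finset ℕ, ∑ k ∈ s, ‖a k‖ ^ 2 ≤ M) ∧
      ∀ z ∈ ball (0:ℂ) 1, ‖g z‖ ^ (p / 2) ≤ (∑' k, a k * z ^ k).re := by
  obtain ⟨M, hM⟩ := hg.exists_polynomial_majorant hp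
  have hR : ∀ n : ℕ, (1 - 1 / ((n : ℝ) + 2)) ∈ Set.Ioo (0:ℝ) 1 := fun n ↦ by
    have h2 : (1:ℝ) / ((n : ℝ) + 2) < 1 := by
      rw [div_lt_one (by positivity)]
      linarith [Nat.cast_nonneg (α := ℝ) n]
    have h3 : (0:ℝ) < 1 / ((n : ℝ) + 2) := by positivity
    exact ⟨by linarith, by linarith⟩
  choose Q hQ hQM using fun n ↦ hM _ (hR n)
  have hB : ∀ n k, ‖(Q n).coeff k‖ ≤ Real.sqrt M := fun n k ↦
    Real.le_sqrt_of_sq_le (by simpa using hQM n {k})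
  have hlim : ∀ k, ∃ c : ℂ, Tendsto (fun n ↦ (Q n).coeff k) (hyperfilter ℕ : Filter ℕ) (𝓝 c) :=
    fun k ↦ by
      obtain ⟨c, -, hc⟩ := (isCompact_closedBall (0:ℂ) (Real.sqrt M)).ultrafilter_le_nhds
        ((hyperfilter ℕ).map fun n ↦ (Q n).coeff k) (by
          rw [le_principal_iff]
          exact Eventually.of_forall (f := (hyperfilter ℕ : Filter ℕ)) fun n ↦ by
            simpa using hB n k)
      exact ⟨c, hc⟩
  choose a ha using hlim
  refine ⟨a, M, fun s ↦ ?_, fun z hz ↦ ?_⟩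
  · exact le_of_tendsto (tendsto_finsetSum s fun k _ ↦ ((ha k).norm.pow 2))
      (Eventually.of_forall fun n ↦ hQM n s)
  · have hz1 := mem_ball_zero_iff.1 hz
    have h1 : Tendsto (fun n ↦ ∑' k, (Q n).coeff k * z ^ k) (hyperfilter ℕ : Filter ℕ)
        (𝓝 (∑' k, a k * z ^ k)) :=
      tendsto_tsum_of_dominated_convergence
        ((summable_geometric_of_lt_one (norm_nonneg z) hz1).mul_left (Real.sqrt M))
        (fun k ↦ (ha k).mul_const _)
        (Eventually.of_forall fun n k ↦ norm_mul_pow_le (hB n k) le_rfl k)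
    have h2 : ∀ n, ∑' k, (Q n).coeff k * z ^ k = (Q n).eval z := fun n ↦ by
      rw [Polynomial.eval_eq_sum, Polynomial.sum, tsum_eq_sum fun k hk ↦ ?_]
      rw [Polynomial.notMem_support_iff.1 hk, zero_mul]
    simp only [h2] at h1
    have h3 : Tendsto (fun n : ℕ ↦ (((1 - 1 / ((n : ℝ) + 2) : ℝ) : ℂ)) * z) atTop (𝓝 z) := by
      have h5 : Tendsto (fun n : ℕ ↦ 1 - 1 / ((n : ℝ) + 2)) atTop (𝓝 (1 - 0)) := by
        refine tendsto_const_nhds.sub (tendsto_const_nhds.div_atTop ?_)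
        exact tendsto_atTop_add_const_right _ _ tendsto_natCast_atTop_atTop
      have h6 := ((Complex.continuous_ofReal.tendsto _).comp h5).mul_const z
      simpa using h6
    have h4 : Tendsto (fun n : ℕ ↦ ‖g ((((1 - 1 / ((n : ℝ) + 2) : ℝ) : ℂ)) * z)‖ ^ (p / 2))
        (hyperfilter ℕ : Filter ℕ) (𝓝 (‖g z‖ ^ (p / 2))) := by
      have h7 : ContinuousAt g z :=
        (hg.1.differentiableAt (isOpen_ball.mem_nhds hz)).continuousAt
      exact ((h7.tendsto.comp h3).norm.rpow_const (Or.inr (by linarith))).mono_left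
        (Nat.cofinite_eq_atTop ▸ hyperfilter_le_cofinite)
    exact le_of_tendsto_of_tendsto h4 ((Complex.continuous_re.tendsto _).comp h1)
      (Eventually.of_forall fun n ↦ hQ n z (ball_subset_closedBall hz))

lemma norm_mul_inv_one_add_sq_le {p A : ℝ} (hp : 1 ≤ p) (hA : 0 < A) {g Φ : ℂ}
    (h : ‖g‖ ^ (p / 2) ≤ Φ.re) : ‖g * ((1 + Φ / A)⁻¹) ^ 2‖ ≤ A ^ (2 / p) := by
  have hx : 0 ≤ ‖g‖ ^ (p / 2) := by positivity
  set y : ℝ := 1 + Φ.re / A with hy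
  have hy1 : 1 ≤ y := by
    have : 0 ≤ Φ.re / A := div_nonneg (hx.trans h) hA.le
    linarith
  have hyn : y ≤ ‖1 + Φ / A‖ := by
    refine le_trans (le_of_eq ?_) (Complex.re_le_norm _)
    rw [hy, Complex.add_re, Complex.div_ofReal_re, Complex.one_re]
  have hgy : ‖g‖ ≤ A ^ (2 / p) * y ^ 2 := by
    calc ‖g‖ = (‖g‖ ^ (p / 2)) ^ (2 / p) := by
          rw [← Real.rpow_mul (norm_nonneg _)]
          rw [show p / 2 * (2 / p) = 1 by field_simp, Real.rpow_one]
      _ ≤ (A * y) ^ (2 / p) := by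
          refine Real.rpow_le_rpow hx ?_ (by positivity)
          rw [hy, mul_add, mul_div_cancel₀ _ hA.ne']
          linarith
      _ = A ^ (2 / p) * y ^ (2 / p) := Real.mul_rpow hA.le (by linarith)
      _ ≤ A ^ (2 / p) * y ^ 2 := by
          gcongr
          rw [← Real.rpow_natCast]
          refine Real.rpow_le_rpow_of_exponent_le hy1 ?_
          rw [div_le_iff₀ (by linarith)]
          push_cast
          linarith
  rw [norm_mul, norm_pow, norm_inv, inv_pow, ← div_eq_mul_inv,
    div_le_iff₀ (pow_pos (by linarith) 2)]
  exact hgy.trans (by gcongr)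

lemma rpow_le_self_of_mem_unitInterval {x p : ℝ} (h0 : 0 ≤ x) (h1 : x ≤ 1) (hp : 1 ≤ p) :
    x ^ p ≤ x := by
  simpa using Real.rpow_le_rpow_of_exponent_ge_of_imp h0 h1 hp (by intros; linarith)

/-- Bounded holomorphic functions are dense in `H^p`. -/
lemma MemHp.exists_bounded_approx {p : ℝ} (hp : 1 ≤ p) {g : ℂ → ℂ} (hg : MemHp p g) {ε : ℝ}
    (hε : 0 < ε) :
    ∃ (b : ℂ → ℂ) (C : ℝ), DifferentiableOn ℂ b (ball (0:ℂ) 1) ∧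
      (∀ z ∈ ball (0:ℂ) 1, ‖b z‖ ≤ C) ∧
      ∀ r ∈ Set.Ioo (0:ℝ) 1, Real.circleAverage (fun z ↦ ‖g z - b z‖ ^ p) 0 r ≤ ε := by
  obtain ⟨a, M, haM, ha⟩ := hg.exists_powerSeries_majorant hp
  have haB : ∀ k, ‖a k‖ ≤ Real.sqrt M := fun k ↦ Real.le_sqrt_of_sq_le (by simpa using haM {k})
  have hΦd := differentiableOn_powerSeries haB
  set D : ℝ := 2 ^ p * 2 with hD
  have hDpos : 0 < D := by positivity
  obtain ⟨N, hN⟩ := exists_circleAverage_sq_norm_sub_le haM (ε := ε / (2 * D)) (by positivity)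
  set Φ : ℂ → ℂ := fun z ↦ ∑' k, a k * z ^ k with hΦ
  set T : ℂ → ℂ := fun z ↦ ∑ k ∈ Finset.range N, a k * z ^ k with hT
  have hTc : Continuous T := by fun_prop
  obtain ⟨B, hB⟩ := (isCompact_closedBall (0:ℂ) 1).exists_bound_of_continuousOn hTc.continuousOn
  set η : ℝ := ε / (4 * D * (B ^ 2 + 1)) with hη
  have hηpos : 0 < η := by positivity
  set A : ℝ := 2 * ‖Φ 0‖ / η ^ 2 + 1 with hA
  have hApos : 0 < A := by positivity
  set F : ℂ → ℂ := fun z ↦ Φ z / A with hF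
  have hFd : DifferentiableOn ℂ F (ball (0:ℂ) 1) := hΦd.div_const _
  have hFre : ∀ z ∈ ball (0:ℂ) 1, 0 ≤ (F z).re := fun z hz ↦ by
    rw [hF, Complex.div_ofReal_re]
    have h1 : 0 ≤ ‖g z‖ ^ (p / 2) := by positivity
    exact div_nonneg (h1.trans (ha z hz)) hApos.le
  have hwd : DifferentiableOn ℂ (fun z ↦ (1 + F z)⁻¹) (ball (0:ℂ) 1) :=
    (hFd.const_add 1).fun_inv fun z hz ↦ one_add_ne_zero_of_re_nonneg (hFre z hz)
  have hbd : DifferentiableOn ℂ (fun z ↦ g z * ((1 + F z)⁻¹) ^ 2) (ball (0:ℂ) 1) :=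
    hg.1.mul (hwd.pow 2)
  refine ⟨_, A ^ (2 / p), hbd, fun z hz ↦ norm_mul_inv_one_add_sq_le hp hApos (ha z hz),
    fun r hr ↦ ?_⟩
  have hF0 : 2 * ‖F 0‖ / η ≤ η := by
    have hAη : A * η ^ 2 = 2 * ‖Φ 0‖ + η ^ 2 := by
      rw [hA]
      field_simp
    rw [hF, norm_div, Complex.norm_real, Real.norm_of_nonneg hApos.le, div_le_iff₀ hηpos,
      ← mul_div_assoc, div_le_iff₀ hApos]
    nlinarith
  have hint1 : CircleIntegrable (fun z ↦ ‖Φ z - T z‖ ^ 2) 0 r :=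
    circleIntegrable_of_continuousOn_unitBall
      ((hΦd.continuousOn.sub hTc.continuousOn).norm.pow 2) hr
  have hint2 : CircleIntegrable (fun z ↦ ‖1 - (1 + F z)⁻¹‖) 0 r :=
    circleIntegrable_of_continuousOn_unitBall
      (continuousOn_const.sub hwd.continuousOn).norm hr
  have hav := circleAverage_norm_one_sub_inv_one_add_le hFd hFre hηpos hr
  calc _ ≤ Real.circleAverage
        (fun z ↦ D • ‖Φ z - T z‖ ^ 2 + (D * B ^ 2) • ‖1 - (1 + F z)⁻¹‖) 0 r := by
        refine Real.circleAverage_mono (circleIntegrable_of_continuousOn_unitBall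
          ((hg.1.continuousOn.sub hbd.continuousOn).norm.rpow_const
            fun _ _ ↦ Or.inr (by linarith)) hr)
          (hint1.const_smul.add hint2.const_smul) fun z hz ↦ ?_
        rw [abs_of_pos hr.1] at hz
        replace hz := sphere_subset_unitBall hr hz
        have hx1 := norm_one_sub_inv_one_add_le_one (hFre z hz)
        have hw1 := norm_inv_one_add_le (hFre z hz)
        have hTz := hB z (ball_subset_closedBall hz)
        set w := (1 + F z)⁻¹
        have h1 : g z - g z * w ^ 2 = g z * (1 - w) * (1 + w) := by ring
        have h2 : ‖1 + w‖ ≤ 2 := (norm_add_le _ _).trans (by rw [norm_one]; linarith)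
        have h3 : ‖g z‖ ^ p ≤ ‖Φ z‖ ^ 2 := by
          calc ‖g z‖ ^ p = (‖g z‖ ^ (p / 2)) ^ 2 := by
                rw [← Real.rpow_natCast, ← Real.rpow_mul (norm_nonneg _)]
                congr 1
                push_cast
                ring
            _ ≤ ‖Φ z‖ ^ 2 := by
                gcongr
                exact (ha z hz).trans (Complex.re_le_norm _)
        have h4 : ‖Φ z‖ ≤ ‖Φ z - T z‖ + B := by
          calc ‖Φ z‖ = ‖(Φ z - T z) + T z‖ := by rw [sub_add_cancel]
            _ ≤ _ := (norm_add_le _ _).trans (by gcongr)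
        have h5 := rpow_le_self_of_mem_unitInterval (norm_nonneg (1 - w)) hx1 hp
        rw [h1, norm_mul, norm_mul, Real.mul_rpow (by positivity) (by positivity),
          Real.mul_rpow (by positivity) (by positivity), smul_eq_mul, smul_eq_mul, hD]
        have hB0 : 0 ≤ B := (norm_nonneg _).trans hTz
        have hp0 : 0 ≤ p := by linarith
        set x := ‖1 - w‖
        have hx0 : 0 ≤ x := norm_nonneg _
        set d := ‖Φ z - T z‖
        have hd0 : 0 ≤ d := norm_nonneg _
        calc ‖g z‖ ^ p * x ^ p * ‖1 + w‖ ^ p ≤ (d + B) ^ 2 * x * 2 ^ p := by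
              gcongr
              exact h3.trans (by gcongr)
          _ ≤ (2 * d ^ 2 + 2 * B ^ 2) * x * 2 ^ p := by
              gcongr
              nlinarith [sq_nonneg (d - B)]
          _ = 2 ^ p * 2 * (d ^ 2 * x) + 2 ^ p * 2 * B ^ 2 * x := by ring
          _ ≤ 2 ^ p * 2 * (d ^ 2 * 1) + 2 ^ p * 2 * B ^ 2 * x := by gcongr
          _ = _ := by ring
    _ = D * Real.circleAverage (fun z ↦ ‖Φ z - T z‖ ^ 2) 0 r +
          (D * B ^ 2) * Real.circleAverage (fun z ↦ ‖1 - (1 + F z)⁻¹‖) 0 r := by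
        rw [Real.circleAverage_fun_add (f₁ := fun z ↦ D • ‖Φ z - T z‖ ^ 2)
          (f₂ := fun z ↦ (D * B ^ 2) • ‖1 - (1 + F z)⁻¹‖) hint1.const_smul hint2.const_smul,
          Real.circleAverage_fun_smul, Real.circleAverage_fun_smul, smul_eq_mul, smul_eq_mul]
    _ ≤ D * (ε / (2 * D)) + (D * (B ^ 2 + 1)) * (2 * η) := by
        have h0 : 0 ≤ Real.circleAverage (fun z ↦ ‖1 - (1 + F z)⁻¹‖) 0 r :=
          Real.circleAverage_nonneg_of_nonneg fun _ _ ↦ norm_nonneg _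
        gcongr
        · exact hN r hr
        · linarith
        · linarith
    _ = ε := by
        rw [hη]
        field_simp
        ring

/-- Compact subsets of the circle of arc length zero have covers by small disks of equal radius
with small total radius. -/
lemma exists_finset_cover_of_arcMeasure_eq_zero {K : Set ℂ} (hKc : IsCompact K)
    (hKT : K ⊆ sphere (0:ℂ) 1) (hKm : arcMeasure K = 0) {η : ℝ} (hη : 0 < η) :
    ∃ (S : Finset ℂ) (δ : ℝ), 0 < δ ∧ (S.card : ℝ) * δ ≤ η ∧
      (∀ ξ ∈ S, ξ ∈ sphere (0:ℂ) 1) ∧ ∀ ζ ∈ K, ∃ ξ ∈ S, dist ζ ξ ≤ δ := by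
  set e : ℝ → ℂ := fun θ ↦ Complex.exp ((θ : ℂ) * Complex.I) with he
  have hec : Continuous e := by fun_prop
  set E : Set ℝ := Set.Icc 0 (2 * Real.pi) ∩ e ⁻¹' K with hE
  have hEc : IsCompact E := isCompact_Icc.inter_right (hKc.isClosed.preimage hec)
  have hE0 : volume E = 0 := by
    have hsub : E ⊆ {θ : ℝ | θ ∈ Set.Ico (0:ℝ) (2 * Real.pi) ∧
        Complex.exp ((θ : ℂ) * Complex.I) ∈ K} ∪ {2 * Real.pi} := fun θ hθ ↦ by
      rcases eq_or_lt_of_le hθ.1.2 with h | h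
      · exact Or.inr h
      · exact Or.inl ⟨⟨hθ.1.1, h⟩, hθ.2⟩
    refine measure_mono_null hsub (measure_union_null hKm ?_)
    simp
  have hlim := tendsto_measure_cthickening_of_isCompact (μ := volume) hEc
  rw [hE0] at hlim
  have hev := hlim.eventually (gt_mem_nhds (ENNReal.ofReal_pos.2 hη))
  obtain ⟨δ, hδη, hδ⟩ := ((hev.filter_mono (nhdsWithin_le_nhds (s := Set.Ioi 0))).and
    self_mem_nhdsWithin).exists
  replace hδ : 0 < δ := hδ
  obtain ⟨n, hn⟩ := exists_nat_gt (2 * Real.pi / δ)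
  rw [div_lt_iff₀ hδ] at hn
  set I : ℕ → Set ℝ := fun k ↦ Set.Ico (k * δ) ((k + 1) * δ) with hI
  classical
  set J : Finset ℕ := (Finset.range n).filter fun k ↦ (I k ∩ E).Nonempty with hJ
  have hJne : ∀ k : J, (I k ∩ E).Nonempty := fun k ↦ (Finset.mem_filter.1 k.2).2
  choose θ hθ using hJne
  have hIclose : ∀ k, ∀ x ∈ I k, ∀ y ∈ I k, dist x y ≤ δ := fun k x hx y hy ↦ by
    rw [Real.dist_eq, abs_le]
    have h1 := hx.1; have h2 := hx.2; have h3 := hy.1; have h4 := hy.2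
    constructor <;> linarith
  have hIdisj : Pairwise (Function.onFun Disjoint I) := by
    intro k l hkl
    refine Set.disjoint_left.2 fun x hx hy ↦ hkl ?_
    have h1 : (k : ℝ) < l + 1 := lt_of_mul_lt_mul_right (hx.1.trans_lt hy.2) hδ.le
    have h2 : (l : ℝ) < k + 1 := lt_of_mul_lt_mul_right (hy.1.trans_lt hx.2) hδ.le
    have h3 : k < l + 1 := by exact_mod_cast h1
    have h4 : l < k + 1 := by exact_mod_cast h2
    omega
  have hcard : (J.card : ℝ) * δ ≤ η := by
    have h1 : volume (⋃ k ∈ J, I k) = ∑ k ∈ J, volume (I k) :=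
      measure_biUnion_finset (fun k _ l _ hkl ↦ hIdisj hkl) fun k _ ↦ measurableSet_Ico
    have h2 : (⋃ k ∈ J, I k) ⊆ cthickening δ E := by
      refine Set.iUnion₂_subset fun k hk x hx ↦ ?_
      exact mem_cthickening_of_dist_le x (θ ⟨k, hk⟩) δ E (hθ ⟨k, hk⟩).2
        (hIclose k x hx _ (hθ ⟨k, hk⟩).1)
    have h3 : ∀ k, volume (I k) = ENNReal.ofReal δ := fun k ↦ by
      rw [hI, Real.volume_Ico]
      congr 1
      ring
    have h4 := (measure_mono h2).trans hδη.le
    rw [h1, Finset.sum_congr rfl fun k _ ↦ h3 k, Finset.sum_const, nsmul_eq_mul,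
      ← ENNReal.ofReal_natCast, ← ENNReal.ofReal_mul (by positivity),
      ENNReal.ofReal_le_ofReal_iff hη.le] at h4
    exact h4
  refine ⟨Finset.univ.image fun k : J ↦ e (θ k), δ, hδ, ?_, ?_, ?_⟩
  · refine le_trans ?_ hcard
    gcongr
    exact Finset.card_image_le.trans (by simp)
  · intro ξ hξ
    obtain ⟨k, -, rfl⟩ := Finset.mem_image.1 hξ
    rw [mem_sphere_zero_iff_norm, he]
    exact Complex.norm_exp_ofReal_mul_I _
  · intro ζ hζ
    obtain ⟨t, ht, hte⟩ : ∃ t ∈ Set.Ioc (0:ℝ) (2 * Real.pi), e t = ζ := by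
      have h1 : ζ ∈ circleMap 0 1 '' Set.Ioc 0 (2 * Real.pi) := by
        rw [image_circleMap_Ioc, abs_one]
        exact hKT hζ
      obtain ⟨t, ht, h⟩ := h1
      exact ⟨t, ht, by rw [← h]; simp [circleMap, he]⟩
    have htE : t ∈ E := ⟨Set.Ioc_subset_Icc_self ht, by rw [Set.mem_preimage, hte]; exact hζ⟩
    have htI : t ∈ I ⌊t / δ⌋₊ := by
      refine ⟨?_, ?_⟩
      · rw [← le_div_iff₀ hδ]
        exact Nat.floor_le (div_nonneg ht.1.le hδ.le)
      · rw [← div_lt_iff₀ hδ]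
        exact Nat.lt_floor_add_one _
    have hkJ : ⌊t / δ⌋₊ ∈ J := by
      refine Finset.mem_filter.2 ⟨Finset.mem_range.2 ?_, t, htI, htE⟩
      have h1 : (⌊t / δ⌋₊ : ℝ) < n :=
        lt_of_mul_lt_mul_right (htI.1.trans_lt (ht.2.trans_lt hn)) hδ.le
      exact_mod_cast h1
    refine ⟨e (θ ⟨_, hkJ⟩), Finset.mem_image_of_mem _ (Finset.mem_univ _), ?_⟩
    rw [← hte]
    have h2 := hIclose _ t htI _ (hθ ⟨_, hkJ⟩).1
    have h3 := (lipschitzWith_circleMap 0 1).dist_le_mul t (θ ⟨_, hkJ⟩)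
    simp [circleMap] at h3
    exact h3.trans h2

lemma one_ninth_le_re_div {δ : ℝ} (hδ : 0 < δ) {y : ℂ} (hy : δ ≤ y.re) (hy3 : ‖y‖ ≤ 3 * δ) :
    1 / 9 ≤ ((δ : ℂ) / y).re := by
  have h0 : 0 < Complex.normSq y := Complex.normSq_pos.2 fun h ↦ by
    rw [h, Complex.zero_re] at hy
    linarith
  have h1 : Complex.normSq y ≤ 9 * δ ^ 2 := by
    rw [Complex.normSq_eq_norm_sq]
    nlinarith [norm_nonneg y]
  rw [div_eq_mul_inv (δ : ℂ), Complex.re_ofReal_mul, Complex.inv_re, ← mul_div_assoc,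
    le_div_iff₀ h0]
  nlinarith

/-- Holomorphic functions on the disk with nonnegative real part that are small at the origin and
large near a given compact null set of the circle. -/
lemma exists_re_large_near_of_arcMeasure_eq_zero {K : Set ℂ} (hKc : IsCompact K)
    (hKT : K ⊆ sphere (0:ℂ) 1) (hKm : arcMeasure K = 0) {N η : ℝ} (hN : 0 < N) (hη : 0 < η) :
    ∃ (F : ℂ → ℂ) (δ : ℝ), 0 < δ ∧ DifferentiableOn ℂ F (ball (0:ℂ) 1) ∧
      (∀ z ∈ ball (0:ℂ) 1, 0 ≤ (F z).re) ∧ ‖F 0‖ ≤ η ∧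
      ∀ ζ ∈ K, ∀ z ∈ ball (0:ℂ) 1, dist z ζ ≤ δ → N ≤ (F z).re := by
  obtain ⟨S, δ, hδ, hSδ, hS, hcov⟩ :=
    exists_finset_cover_of_arcMeasure_eq_zero hKc hKT hKm (η := η / (9 * N)) (by positivity)
  have hre : ∀ z ∈ ball (0:ℂ) 1, ∀ ξ ∈ S, δ ≤ (1 + (δ : ℂ) - z * starRingEnd ℂ ξ).re := by
    intro z hz ξ hξ
    have h1 : (z * starRingEnd ℂ ξ).re ≤ 1 := by
      refine (Complex.re_le_norm _).trans ?_
      rw [norm_mul, RCLike.norm_conj, mem_sphere_zero_iff_norm.1 (hS ξ hξ), mul_one]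
      exact (mem_ball_zero_iff.1 hz).le
    rw [Complex.sub_re, Complex.add_re, Complex.one_re, Complex.ofReal_re]
    linarith
  have hterm : ∀ z ∈ ball (0:ℂ) 1, ∀ ξ ∈ S,
      0 ≤ ((δ : ℂ) / (1 + (δ : ℂ) - z * starRingEnd ℂ ξ)).re := fun z hz ξ hξ ↦ by
    rw [div_eq_mul_inv, Complex.re_ofReal_mul, Complex.inv_re]
    exact mul_nonneg hδ.le (div_nonneg (hδ.le.trans (hre z hz ξ hξ)) (Complex.normSq_nonneg _))
  refine ⟨fun z ↦ ((9 * N : ℝ) : ℂ) * ∑ ξ ∈ S, (δ : ℂ) / (1 + (δ : ℂ) - z * starRingEnd ℂ ξ), δ,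
    hδ, ?_, fun z hz ↦ ?_, ?_, fun ζ hζ z hz hzζ ↦ ?_⟩
  · refine (DifferentiableOn.fun_sum fun ξ hξ ↦ ?_).const_mul _
    refine (differentiableOn_const _).fun_div (by fun_prop) fun z hz h ↦ ?_
    have := hre z hz ξ hξ
    rw [h, Complex.zero_re] at this
    linarith
  · rw [Complex.re_ofReal_mul, Complex.re_sum]
    exact mul_nonneg (by positivity) (Finset.sum_nonneg fun ξ hξ ↦ hterm z hz ξ hξ)
  · rw [norm_mul, Complex.norm_real, Real.norm_of_nonneg (by positivity)]
    have h1 : ‖∑ ξ ∈ S, (δ : ℂ) / (1 + (δ : ℂ) - 0 * starRingEnd ℂ ξ)‖ ≤ ∑ _ξ ∈ S, δ := by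
      refine norm_sum_le_of_le _ fun ξ _ ↦ ?_
      rw [zero_mul, sub_zero, norm_div, ← Complex.ofReal_one, ← Complex.ofReal_add,
        Complex.norm_real, Complex.norm_real, Real.norm_of_nonneg hδ.le,
        Real.norm_of_nonneg (by positivity)]
      exact div_le_self hδ.le (by linarith)
    rw [Finset.sum_const, nsmul_eq_mul] at h1
    refine (mul_le_mul_of_nonneg_left (h1.trans hSδ) (by positivity)).trans_eq ?_
    exact mul_div_cancel₀ _ (by positivity)
  · obtain ⟨ξ, hξ, hdist⟩ := hcov ζ hζ
    have hξ1 : ξ * starRingEnd ℂ ξ = 1 := by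
      rw [Complex.mul_conj, Complex.normSq_eq_norm_sq, mem_sphere_zero_iff_norm.1 (hS ξ hξ)]
      simp
    have hy : ‖1 + (δ : ℂ) - z * starRingEnd ℂ ξ‖ ≤ 3 * δ := by
      have h1 : 1 + (δ : ℂ) - z * starRingEnd ℂ ξ = δ - (z - ξ) * starRingEnd ℂ ξ := by
        linear_combination -hξ1
      rw [h1]
      refine (norm_sub_le _ _).trans ?_
      rw [norm_mul, RCLike.norm_conj, mem_sphere_zero_iff_norm.1 (hS ξ hξ), mul_one,
        Complex.norm_real, Real.norm_of_nonneg hδ.le, ← dist_eq_norm]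
      linarith [dist_triangle z ζ ξ]
    rw [Complex.re_ofReal_mul, Complex.re_sum]
    have h2 := one_ninth_le_re_div hδ (hre z hz ξ hξ) hy
    have h3 := h2.trans (Finset.single_le_sum (f := fun ξ ↦
      ((δ : ℂ) / (1 + (δ : ℂ) - z * starRingEnd ℂ ξ)).re) (fun ξ hξ ↦ hterm z hz ξ hξ) hξ)
    nlinarith

/-- Interpolation between a bounded holomorphic function and a polynomial: the new function stays
close in mean to the former and is uniformly close to the latter near a null set of the circle. -/
lemma exists_bounded_approx_near_of_arcMeasure_eq_zero {p : ℝ} (hp : 1 ≤ p) {K : Set ℂ}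
    (hKc : IsCompact K) (hKT : K ⊆ sphere (0:ℂ) 1) (hKm : arcMeasure K = 0) (Q : Polynomial ℂ)
    {b : ℂ → ℂ} {C : ℝ} (hb : DifferentiableOn ℂ b (ball (0:ℂ) 1))
    (hC : ∀ z ∈ ball (0:ℂ) 1, ‖b z‖ ≤ C) {ε κ : ℝ} (hε : 0 < ε) (hκ : 0 < κ) :
    ∃ (f : ℂ → ℂ) (B δ : ℝ), 0 < δ ∧ DifferentiableOn ℂ f (ball (0:ℂ) 1) ∧
      (∀ z ∈ ball (0:ℂ) 1, ‖f z‖ ≤ B) ∧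
      (∀ r ∈ Set.Ioo (0:ℝ) 1, Real.circleAverage (fun z ↦ ‖f z - b z‖ ^ p) 0 r ≤ ε) ∧
      ∀ ζ ∈ K, ∀ z ∈ ball (0:ℂ) 1, dist z ζ < δ → ‖f z - Q.eval ζ‖ ≤ κ := by
  have hp0 : 0 ≤ p := by linarith
  obtain ⟨M, hM⟩ :=
    (isCompact_closedBall (0:ℂ) 1).exists_bound_of_continuousOn Q.continuous.continuousOn
  have hC0 : 0 ≤ C := (norm_nonneg _).trans (hC 0 (by simp))
  have hM0 : 0 ≤ M := (norm_nonneg _).trans (hM 0 (by simp))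
  set A : ℝ := M + C + 1 with hA
  have hApos : 0 < A := by positivity
  have hdiff : ∀ z ∈ ball (0:ℂ) 1, ‖Q.eval z - b z‖ ≤ A := fun z hz ↦ by
    have h1 := hM z (ball_subset_closedBall hz)
    have h2 := hC z hz
    exact (norm_sub_le _ _).trans (by linarith)
  set η : ℝ := ε / (2 * A ^ p) with hη
  have hηpos : 0 < η := by positivity
  obtain ⟨F, δ₁, hδ₁, hFd, hFre, hF0, hFK⟩ := exists_re_large_near_of_arcMeasure_eq_zero hKc hKT
    hKm (N := 2 * A / κ) (η := η ^ 2 / 2) (by positivity) (by positivity)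
  obtain ⟨δ₂, hδ₂, hunif⟩ := Metric.uniformContinuousOn_iff.1
    ((isCompact_closedBall (0:ℂ) 1).uniformContinuousOn_of_continuous Q.continuous.continuousOn)
    (κ / 2) (by positivity)
  have hwd : DifferentiableOn ℂ (fun z ↦ (1 + F z)⁻¹) (ball (0:ℂ) 1) :=
    (hFd.const_add 1).fun_inv fun z hz ↦ one_add_ne_zero_of_re_nonneg (hFre z hz)
  have hfd : DifferentiableOn ℂ (fun z ↦ b z + (1 - (1 + F z)⁻¹) * (Q.eval z - b z))
      (ball (0:ℂ) 1) :=
    hb.add ((hwd.const_sub 1).mul (Q.differentiable.differentiableOn.sub hb))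
  refine ⟨_, C + 1 * A, min δ₁ δ₂, lt_min hδ₁ hδ₂, hfd, fun z hz ↦ ?_, fun r hr ↦ ?_,
    fun ζ hζ z hz hzζ ↦ ?_⟩
  · refine (norm_add_le _ _).trans (add_le_add (hC z hz) ?_)
    rw [norm_mul]
    exact mul_le_mul (norm_one_sub_inv_one_add_le_one (hFre z hz)) (hdiff z hz) (norm_nonneg _)
      zero_le_one
  · have hint : CircleIntegrable (fun z ↦ ‖1 - (1 + F z)⁻¹‖) 0 r :=
      circleIntegrable_of_continuousOn_unitBall
        (continuousOn_const.sub hwd.continuousOn).norm hr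
    calc _ ≤ Real.circleAverage (fun z ↦ (A ^ p) • ‖1 - (1 + F z)⁻¹‖) 0 r := by
          refine Real.circleAverage_mono (circleIntegrable_of_continuousOn_unitBall
            ((hfd.continuousOn.sub hb.continuousOn).norm.rpow_const fun _ _ ↦ Or.inr hp0) hr)
            hint.const_smul fun z hz ↦ ?_
          rw [abs_of_pos hr.1] at hz
          replace hz := sphere_subset_unitBall hr hz
          rw [add_sub_cancel_left, norm_mul, Real.mul_rpow (norm_nonneg _) (norm_nonneg _),
            smul_eq_mul, mul_comm]
          refine mul_le_mul (Real.rpow_le_rpow (norm_nonneg _) (hdiff z hz) hp0) ?_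
            (by positivity) (by positivity)
          exact rpow_le_self_of_mem_unitInterval (norm_nonneg _)
            (norm_one_sub_inv_one_add_le_one (hFre z hz)) hp
      _ ≤ A ^ p * (η + η) := by
          rw [Real.circleAverage_fun_smul, smul_eq_mul]
          gcongr
          refine (circleAverage_norm_one_sub_inv_one_add_le hFd hFre hηpos hr).trans ?_
          gcongr
          rw [div_le_iff₀ hηpos]
          nlinarith
      _ = ε := by
          rw [hη]
          field_simp
          ring
  · have h1 : 2 * A / κ ≤ (F z).re := hFK ζ hζ z hz (hzζ.le.trans (min_le_left _ _))
    have hw : ‖(1 + F z)⁻¹‖ ≤ κ / (2 * A) := by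
      have h2 : 2 * A / κ ≤ ‖1 + F z‖ := by
        refine le_trans ?_ (Complex.re_le_norm _)
        rw [Complex.add_re, Complex.one_re]
        linarith
      rw [norm_inv, ← inv_div (2 * A) κ]
      exact inv_anti₀ (by positivity) h2
    have hQ := hunif z (ball_subset_closedBall hz) ζ (sphere_subset_closedBall (hKT hζ))
      (hzζ.trans_le (min_le_right _ _))
    rw [dist_eq_norm] at hQ
    have h3 : b z + (1 - (1 + F z)⁻¹) * (Q.eval z - b z) - Q.eval ζ =
        (Q.eval z - Q.eval ζ) - (1 + F z)⁻¹ * (Q.eval z - b z) := by ring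
    rw [h3]
    calc _ ≤ ‖Q.eval z - Q.eval ζ‖ + ‖(1 + F z)⁻¹‖ * ‖Q.eval z - b z‖ := by
          rw [← norm_mul]
          exact norm_sub_le _ _
      _ ≤ κ / 2 + κ / (2 * A) * A := by
          gcongr
          exact hdiff z hz
      _ = κ := by
          field_simp
          ring

lemma norm_affine_lt_one {r : ℝ} (hr : r ∈ Set.Ico (0:ℝ) 1) {ζ z : ℂ} (hζ : ‖ζ‖ = 1)
    (hz : ‖z‖ < 1) : ‖(r : ℂ) * (ζ - z) + z‖ < 1 := by
  have h1 : (r : ℂ) * (ζ - z) + z = r * ζ + ((1 - r : ℝ) : ℂ) * z := by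
    push_cast
    ring
  have h2 : 0 < 1 - r := sub_pos.2 hr.2
  rw [h1]
  refine (norm_add_le _ _).trans_lt ?_
  rw [norm_mul, norm_mul, Complex.norm_real, Complex.norm_real, Real.norm_of_nonneg hr.1,
    Real.norm_of_nonneg h2.le, hζ]
  nlinarith

lemma dist_affine_le {r : ℝ} (hr : r ≤ 1) {ζ z : ℂ} (hζ : ‖ζ‖ = 1)
    (hz : ‖z‖ ≤ 1) : dist ((r : ℂ) * (ζ - z) + z) ζ ≤ 2 * (1 - r) := by
  have h1 : (r : ℂ) * (ζ - z) + z - ζ = ((1 - r : ℝ) : ℂ) * (z - ζ) := by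
    push_cast
    ring
  have h2 : 0 ≤ 1 - r := sub_nonneg.2 hr
  rw [dist_eq_norm, h1, norm_mul, Complex.norm_real, Real.norm_of_nonneg h2, mul_comm]
  gcongr
  exact (norm_sub_le _ _).trans (by linarith)

/-- Lemma (hardydense): each `⋃_{r∈ρ} U(j,s,r)` is dense in `H^p(𝔻)`. -/
theorem statement_4 (p : ℝ) (hp : 1 ≤ p)
    (ρ : Set ℝ) (hρ : ρ ⊆ Set.Ico (0:ℝ) 1) (hρ1 : AccPt (1:ℝ) (Filter.principal ρ))
    (K : Set ℂ) (hKc : IsCompact K) (hKT : K ⊆ Metric.sphere (0:ℂ) 1)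
    (hKm : arcMeasure K = 0)
    (P : ℕ → Polynomial ℂ) (hP1 : ∀ j, RatPoly (P j))
    (hP2 : ∀ q : Polynomial ℂ, RatPoly q → ∃ j, P j = q)
    (j s : ℕ) (hs : 1 ≤ s) :
    Dense (⋃ r ∈ ρ, UHp p K P j s r) := by

  have hs0 : (0:ℝ) < s := by exact_mod_cast hs
  refine dense_iff_inter_open.2 fun O hO ⟨g, hg⟩ ↦ ?_
  obtain ⟨ε, hε, hball⟩ := exists_hardyBall_subset hp hO hg
  obtain ⟨b, C, hbd, hbC, hgb⟩ := g.2.exists_bounded_approx hp (ε := (ε / 4) ^ p) (by positivity)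
  obtain ⟨f, B, δ, hδ, hfd, hfB, hfb, hfK⟩ := exists_bounded_approx_near_of_arcMeasure_eq_zero hp
    hKc hKT hKm (P j) hbd hbC (ε := (ε / 4) ^ p) (κ := 1 / (2 * s)) (by positivity)
    (by positivity)
  have hfH : MemHp p f := memHp_of_bounded hp hfd hfB
  have hbH : MemHp p b := memHp_of_bounded hp hbd hbC
  have hfg : hardyNorm p (fun z ↦ f z - g.1 z) < ε := by
    have h1 := hardyNorm_add_le hp (hfH.sub hp hbH) (hbH.sub hp g.2)
    simp only [sub_add_sub_cancel] at h1
    have h2 : hardyNorm p (fun z ↦ f z - b z) ≤ ε / 4 :=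
      hardyNorm_le_of_circleAverage_le hp (by positivity) hfb
    have h3 : hardyNorm p (fun z ↦ b z - g.1 z) ≤ ε / 4 :=
      hardyNorm_le_of_circleAverage_le hp (by positivity) (by simpa only [norm_sub_rev] using hgb)
    linarith
  obtain ⟨r, ⟨hrδ, hrρ⟩, -⟩ := accPt_iff_nhds.1 hρ1 _
    (Ioi_mem_nhds (show 1 - δ / 2 < 1 by linarith))
  rw [Set.mem_Ioi] at hrδ
  refine ⟨⟨f, hfH⟩, hball _ hfg, Set.mem_iUnion₂.2 ⟨r, hrρ, ?_⟩⟩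
  have hbound : (⨆ ζ ∈ K, ⨆ z ∈ closedBall (0:ℂ) ((s : ℝ) / ((s : ℝ) + 1)),
      ‖f ((r : ℂ) * (ζ - z) + z) - (P j).eval ζ‖) ≤ 1 / (2 * s) := by
    have h0 : (0:ℝ) ≤ 1 / (2 * s) := by positivity
    refine Real.iSup_le (fun ζ ↦ Real.iSup_le (fun hζ ↦ Real.iSup_le (fun z ↦
      Real.iSup_le (fun hz ↦ ?_) h0) h0) h0) h0
    have hζ1 := mem_sphere_zero_iff_norm.1 (hKT hζ)
    have hz1 : ‖z‖ < 1 := (mem_closedBall_zero_iff.1 hz).trans_lt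
      ((div_lt_one (by positivity)).2 (lt_add_one _))
    refine hfK ζ hζ _ (mem_ball_zero_iff.2 (norm_affine_lt_one (hρ hrρ) hζ1 hz1)) ?_
    exact (dist_affine_le (hρ hrρ).2.le hζ1 hz1.le).trans_lt (by linarith)
  refine hbound.trans_lt (one_div_lt_one_div_of_lt hs0 ?_)
  linarith
end
end
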